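/- arXiv:0912.1808 — 3 statements merged into one kernel-verified Lean document; each statement's English description precedes it below -/
import Mathlib

section
/- Let F : ℝ × ℂⁿ → ℝ be smooth and periodic in the second variable, and let A₀, A₁ > 0. Then there exist T > 0 and C > 0, depending only on F, A₀ and A₁, with the following property: for every T' > 0 and every solution φ on [0,T'] of the parabolic complex Monge–Ampère flow ∂φ/∂t = log det(Iₙ + H(φ(t,·))) + F(φ, z) with sup_z |φ(0,z)| ≤ A₀ and sup_z |∂φ/∂t(0,z)| ≤ A₁, one has |φ(t,z)| ≤ C and |∂φ/∂t(t,z)| ≤ C for all t ∈ [0, min(T,T')] and all z; in particular |log det(Iₙ + H(φ(t,·)))(z)| ≤ C for such t and z. -/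
open Set Filter Topology
open scoped ComplexOrder

noncomputable section

/-- Real partial derivative of `ψ : ℂⁿ → ℝ` in the direction `x_p`
(the real part of the `p`-th coordinate). -/
def pdx {n : ℕ} (p : Fin n) (ψ : (Fin n → ℂ) → ℝ) : (Fin n → ℂ) → ℝ :=
  fun z => fderiv ℝ ψ z (Pi.single p 1)

/-- Real partial derivative of `ψ : ℂⁿ → ℝ` in the direction `y_p`
(the imaginary part of the `p`-th coordinate). -/
def pdy {n : ℕ} (p : Fin n) (ψ : (Fin n → ℂ) → ℝ) : (Fin n → ℂ) → ℝ :=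
  fun z => fderiv ℝ ψ z (Pi.single p Complex.I)

/-- The complex Hessian of `ψ : ℂⁿ → ℝ`: the `n × n` matrix with entries
`H(ψ)_{p q̄} = ∂²ψ/∂z_p∂z̄_q
  = (1/4)(∂_{x_p}∂_{x_q}ψ + ∂_{y_p}∂_{y_q}ψ) + (i/4)(∂_{x_p}∂_{y_q}ψ − ∂_{y_p}∂_{x_q}ψ)`. -/
def complexHessian {n : ℕ} (ψ : (Fin n → ℂ) → ℝ) (z : Fin n → ℂ) :
    Matrix (Fin n) (Fin n) ℂ :=
  fun p q =>
    (1 / 4 : ℂ) * ((pdx p (pdx q ψ) z + pdy p (pdy q ψ) z : ℝ) : ℂ) +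
      (Complex.I / 4) * ((pdx p (pdy q ψ) z - pdy p (pdx q ψ) z : ℝ) : ℂ)

/-- A function on `ℂⁿ` is (space-)periodic if it is invariant under translations by
the lattice `ℤⁿ + iℤⁿ`. -/
def SpacePeriodic {n : ℕ} (ψ : (Fin n → ℂ) → ℝ) : Prop :=
  ∀ (z : Fin n → ℂ) (a b : Fin n → ℤ),
    ψ (fun p => z p + (a p : ℂ) + (b p : ℂ) * Complex.I) = ψ z

/-- A solution on `[0,T]` of the parabolic complex Monge–Ampère flow
`∂φ/∂t = log det(Iₙ + H(φ(t,·))) + F(φ,z) − log c` on the torus `ℂⁿ/(ℤⁿ+iℤⁿ)`: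
`φ` is smooth on `[0,T] × ℂⁿ`, periodic in `z`, the matrix `Iₙ + H(φ(t,·))` is
positive definite everywhere, and the evolution equation holds. -/
def IsMAFlowSolution {n : ℕ} (F : ℝ → (Fin n → ℂ) → ℝ) (c : ℝ) (T : ℝ)
    (φ : ℝ → (Fin n → ℂ) → ℝ) : Prop :=
  ContDiffOn ℝ (⊤ : ℕ∞) (fun p : ℝ × (Fin n → ℂ) => φ p.1 p.2) (Icc 0 T ×ˢ univ) ∧
  (∀ t ∈ Icc (0 : ℝ) T, SpacePeriodic (φ t)) ∧
  (∀ t ∈ Icc (0 : ℝ) T, ∀ z,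
    ((1 : Matrix (Fin n) (Fin n) ℂ) + complexHessian (φ t) z).PosDef) ∧
  (∀ t ∈ Icc (0 : ℝ) T, ∀ z,
    HasDerivWithinAt (fun s => φ s z)
      (Real.log (((1 : Matrix (Fin n) (Fin n) ℂ) + complexHessian (φ t) z).det.re)
        + F (φ t z) z - Real.log c)
      (Icc 0 T) t)


lemma Matrix.PosSemidef.one_le_det_one_add {ι : Type*} [Fintype ι] [DecidableEq ι]
    {Q : Matrix ι ι ℂ} (hQ : Q.PosSemidef) : 1 ≤ (1 + Q).det := by
  have key : (1 + Q).det = ∏ i, (1 + (hQ.1.eigenvalues i : ℂ)) := by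
    have h := congrArg (Polynomial.eval (-1)) hQ.1.charpoly_eq
    rw [Matrix.eval_charpoly, Polynomial.eval_prod] at h
    simp only [Polynomial.eval_sub, Polynomial.eval_X, Polynomial.eval_C] at h
    have h1 : (Matrix.scalar ι (-1 : ℂ)) - Q = -(1 + Q) := by
      rw [map_neg, map_one]
      abel
    rw [h1, Matrix.det_neg] at h
    have h2 : ∏ i, (-1 - ((hQ.1.eigenvalues i : ℝ) : ℂ))
        = (-1) ^ Fintype.card ι * ∏ i, (1 + ((hQ.1.eigenvalues i : ℝ) : ℂ)) := by
      rw [← Finset.card_univ, ← Finset.prod_const, ← Finset.prod_mul_distrib]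
      exact Finset.prod_congr rfl fun i _ => by ring
    exact mul_left_cancel₀ (pow_ne_zero _ (by norm_num)) (h.trans h2)
  rw [key]
  have : (1 : ℝ) ≤ ∏ i, (1 + hQ.1.eigenvalues i) :=
    Finset.prod_induction _ (1 ≤ ·) (fun _ _ => one_le_mul_of_one_le_of_one_le) le_rfl
      fun i _ => le_add_of_nonneg_right (hQ.eigenvalues_nonneg i)
  exact_mod_cast this

open scoped MatrixOrder in
/-- The determinant is monotone on positive definite matrices. -/
lemma Matrix.PosDef.det_le_det {ι : Type*} [Fintype ι] [DecidableEq ι]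
    {A B : Matrix ι ι ℂ} (hA : A.PosDef) (hAB : (B - A).PosSemidef) : A.det ≤ B.det := by
  set S := CFC.sqrt A with hS
  have hSS : S * S = A := CFC.sqrt_mul_sqrt_self A hA.posSemidef.nonneg
  have hSpsd : S.PosSemidef := Matrix.nonneg_iff_posSemidef.1 (CFC.sqrt_nonneg A)
  have hdet : IsUnit S.det := by
    have h := hA.det_pos.ne'
    rw [← hSS, Matrix.det_mul] at h
    exact (left_ne_zero_of_mul h).isUnit
  have hQ : (S⁻¹ * (B - A) * S⁻¹).PosSemidef := by
    have h := hAB.mul_mul_conjTranspose_same S⁻¹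
    rwa [Matrix.conjTranspose_nonsing_inv, hSpsd.1.eq] at h
  have hB : B = S * (1 + S⁻¹ * (B - A) * S⁻¹) * S := by
    have h : S * (1 + S⁻¹ * (B - A) * S⁻¹) * S
        = S * S + (S * S⁻¹) * (B - A) * (S⁻¹ * S) := by noncomm_ring
    rw [h, Matrix.mul_nonsing_inv _ hdet, Matrix.nonsing_inv_mul _ hdet, hSS]
    simp
  have hBdet : B.det = A.det * (1 + S⁻¹ * (B - A) * S⁻¹).det := by
    conv_lhs => rw [hB]
    rw [Matrix.det_mul, Matrix.det_mul, ← hSS, Matrix.det_mul]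
    ring
  rw [hBdet]
  exact le_mul_of_one_le_right hA.det_pos.le hQ.one_le_det_one_add

/-- The Hermitian matrix associated with a real bilinear form on `ℂⁿ`. -/
def hermitianPart {n : ℕ} (S : (Fin n → ℂ) →L[ℝ] (Fin n → ℂ) →L[ℝ] ℝ) :
    Matrix (Fin n) (Fin n) ℂ :=
  fun p q =>
    (1 / 4 : ℂ) * ((S (Pi.single p 1) (Pi.single q 1)
        + S (Pi.single p Complex.I) (Pi.single q Complex.I) : ℝ) : ℂ) +
      (Complex.I / 4) * ((S (Pi.single p 1) (Pi.single q Complex.I)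
        - S (Pi.single p Complex.I) (Pi.single q 1) : ℝ) : ℂ)

lemma complexHessian_eq_hermitianPart {n : ℕ} {ψ : (Fin n → ℂ) → ℝ} (hψ : ContDiff ℝ 2 ψ)
    (z : Fin n → ℂ) : complexHessian ψ z = hermitianPart (fderiv ℝ (fderiv ℝ ψ) z) := by
  have hd : Differentiable ℝ (fderiv ℝ ψ) :=
    (hψ.fderiv_right (m := 1) (by norm_num)).differentiable (by norm_num)
  have key : ∀ a b : Fin n → ℂ,
      fderiv ℝ (fun y => fderiv ℝ ψ y b) z a = fderiv ℝ (fderiv ℝ ψ) z a b := fun a b => by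
    rw [fderiv_clm_apply (hd z) (differentiableAt_const b)]
    simp
  ext p q
  simp only [complexHessian, hermitianPart, ← key]
  rfl

lemma hermitianPart_sub {n : ℕ} (S R : (Fin n → ℂ) →L[ℝ] (Fin n → ℂ) →L[ℝ] ℝ) :
    hermitianPart (S - R) = hermitianPart S - hermitianPart R := by
  ext p q
  simp only [hermitianPart, Matrix.sub_apply, _root_.sub_apply]
  push_cast
  ring

lemma re_star_dotProduct_hermitianPart {n : ℕ} (S : (Fin n → ℂ) →L[ℝ] (Fin n → ℂ) →L[ℝ] ℝ)
    (x : Fin n → ℂ) :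
    (star x ⬝ᵥ ((hermitianPart S).mulVec x)).re
      = 1 / 4 * (S (star x) (star x) + S (Complex.I • star x) (Complex.I • star x)) := by
  have ha : star x = ∑ p, ((x p).re • (Pi.single p 1 : Fin n → ℂ)
      + (-(x p).im) • (Pi.single p Complex.I : Fin n → ℂ)) := by
    ext q
    simp only [Finset.sum_apply, Pi.add_apply, Pi.smul_apply, Pi.single_apply]
    simp only [smul_ite, smul_zero, Finset.sum_add_distrib, Finset.sum_ite_eq, Finset.mem_univ,
      if_true]
    apply Complex.ext <;> simp
  have hb : Complex.I • star x = ∑ p, ((x p).im • (Pi.single p 1 : Fin n → ℂ)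
      + (x p).re • (Pi.single p Complex.I : Fin n → ℂ)) := by
    ext q
    simp only [Finset.sum_apply, Pi.add_apply, Pi.smul_apply, Pi.single_apply]
    simp only [smul_ite, smul_zero, Finset.sum_add_distrib, Finset.sum_ite_eq, Finset.mem_univ,
      if_true]
    apply Complex.ext <;> simp
  rw [hb, ha]
  simp only [dotProduct, Matrix.mulVec, Finset.mul_sum, Complex.re_sum, map_sum,
    sum_apply]
  rw [← ha, Finset.sum_comm, ← Finset.sum_add_distrib, Finset.mul_sum]
  refine Finset.sum_congr rfl fun q _ => ?_
  rw [← Finset.sum_add_distrib, Finset.mul_sum]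
  refine Finset.sum_congr rfl fun p _ => ?_
  simp [hermitianPart, Complex.mul_re, Complex.mul_im]
  ring

lemma posSemidef_hermitianPart {n : ℕ} {S : (Fin n → ℂ) →L[ℝ] (Fin n → ℂ) →L[ℝ] ℝ}
    (hsymm : ∀ a b, S a b = S b a) (hS : ∀ a, 0 ≤ S a a) : (hermitianPart S).PosSemidef := by
  have hH : (hermitianPart S).IsHermitian := by
    ext p q
    simp only [Matrix.conjTranspose_apply, hermitianPart]
    rw [hsymm (Pi.single q 1) (Pi.single p 1), hsymm (Pi.single q Complex.I) (Pi.single p Complex.I),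
      hsymm (Pi.single q 1) (Pi.single p Complex.I), hsymm (Pi.single q Complex.I) (Pi.single p 1)]
    apply Complex.ext <;> simp
    ring
  refine Matrix.PosSemidef.of_dotProduct_mulVec_nonneg hH fun x => ?_
  rw [Complex.nonneg_iff]
  refine ⟨?_, (hH.im_star_dotProduct_mulVec_self x).symm⟩
  rw [re_star_dotProduct_hermitianPart]
  have h1 := hS (star x)
  have h2 := hS (Complex.I • star x)
  positivity

lemma IsLocalMax.deriv_deriv_nonpos {u : ℝ → ℝ} {s : ℝ} (h : IsLocalMax u s)
    (hc : ContinuousAt u s) : deriv (deriv u) s ≤ 0 := by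
  by_contra! hpos
  have hmin := isLocalMin_of_deriv_deriv_pos hpos h.deriv_eq_zero hc
  have hconst : u =ᶠ[𝓝 s] fun _ => u s := by
    filter_upwards [h, hmin] with y h1 h2 using le_antisymm h1 h2
  have h2 := hconst.deriv.deriv_eq
  simp at h2
  exact hpos.ne' h2

lemma IsLocalMax.fderiv_fderiv_nonpos {E : Type*} [NormedAddCommGroup E] [NormedSpace ℝ E]
    {w : E → ℝ} {z : E} (h : IsLocalMax w z) (hw : ContDiff ℝ 2 w) (a : E) :
    fderiv ℝ (fderiv ℝ w) z a a ≤ 0 := by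
  have hd : Differentiable ℝ w := hw.differentiable (by norm_num)
  have hdd : Differentiable ℝ (fderiv ℝ w) :=
    (hw.fderiv_right (m := 1) (by norm_num)).differentiable (by norm_num)
  have hline : ∀ s : ℝ, HasDerivAt (fun s : ℝ => z + s • a) a s := fun s => by
    simpa using ((hasDerivAt_id s).smul_const a).const_add z
  have h1 : deriv (fun s : ℝ => w (z + s • a)) = fun s => fderiv ℝ w (z + s • a) a := by
    ext s
    exact ((hd _).hasFDerivAt.comp_hasDerivAt s (hline s)).deriv
  have h2 : HasDerivAt (fun s : ℝ => fderiv ℝ w (z + s • a) a)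
      (fderiv ℝ (fderiv ℝ w) z a a) 0 := by
    have h3 := (hdd (z + (0 : ℝ) • a)).hasFDerivAt.comp_hasDerivAt (0 : ℝ) (hline 0)
    simpa using h3.clm_apply (hasDerivAt_const (0 : ℝ) a)
  have hcont : Continuous fun s : ℝ => z + s • a := by fun_prop
  have hmax : IsLocalMax (fun s : ℝ => w (z + s • a)) 0 := by
    have h0 : Tendsto (fun s : ℝ => z + s • a) (𝓝 0) (𝓝 z) := by
      simpa using hcont.tendsto 0
    simpa [IsLocalMax, IsMaxFilter] using h0.eventually h
  have := hmax.deriv_deriv_nonpos (hd.continuous.comp hcont).continuousAt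
  rwa [h1, h2.deriv] at this

/-- The logarithm of the complex Monge–Ampère operator `det(Iₙ + H(ψ))`. -/
def logMA {n : ℕ} (ψ : (Fin n → ℂ) → ℝ) (z : Fin n → ℂ) : ℝ :=
  Real.log (((1 : Matrix (Fin n) (Fin n) ℂ) + complexHessian ψ z).det.re)

lemma logMA_le_logMA {n : ℕ} {u v : (Fin n → ℂ) → ℝ} {z : Fin n → ℂ} (hu : ContDiff ℝ 2 u)
    (hv : ContDiff ℝ 2 v)
    (hpos : ((1 : Matrix (Fin n) (Fin n) ℂ) + complexHessian u z).PosDef)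
    (hmax : IsLocalMax (fun y => u y - v y) z) : logMA u z ≤ logMA v z := by
  have hfd : fderiv ℝ (fderiv ℝ fun y => u y - v y) z
      = fderiv ℝ (fderiv ℝ u) z - fderiv ℝ (fderiv ℝ v) z := by
    have h1 : (fderiv ℝ fun y => u y - v y) = fun y => fderiv ℝ u y - fderiv ℝ v y := by
      ext1 y
      exact fderiv_fun_sub (hu.differentiable (by norm_num) y) (hv.differentiable (by norm_num) y)
    rw [h1]
    exact fderiv_fun_sub
      ((hu.fderiv_right (m := 1) (by norm_num)).differentiable (by norm_num) z)
      ((hv.fderiv_right (m := 1) (by norm_num)).differentiable (by norm_num) z)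
  have hpsd : (complexHessian v z - complexHessian u z).PosSemidef := by
    rw [complexHessian_eq_hermitianPart hu, complexHessian_eq_hermitianPart hv,
      ← hermitianPart_sub]
    apply posSemidef_hermitianPart
    · intro a b
      have h1 := hu.contDiffAt.isSymmSndFDerivAt (x := z) (by simp) a b
      have h2 := hv.contDiffAt.isSymmSndFDerivAt (x := z) (by simp) a b
      simp [h1, h2]
    · intro a
      have h := hmax.fderiv_fderiv_nonpos (hu.sub hv) a
      rw [hfd] at h
      simp only [sub_apply] at h ⊢
      linarith
  refine Real.log_le_log (Complex.pos_iff.1 hpos.det_pos).1 ?_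
  refine (Complex.le_def.1 (hpos.det_le_det ?_)).1
  rwa [add_sub_add_left_eq_sub]

/-- The fundamental domain of the lattice `ℤⁿ + iℤⁿ`. -/
def unitCell (n : ℕ) : Set (Fin n → ℂ) :=
  univ.pi fun _ => Icc (0 : ℝ) 1 ×ℂ Icc (0 : ℝ) 1

lemma isCompact_unitCell (n : ℕ) : IsCompact (unitCell n) :=
  isCompact_univ_pi fun _ => isCompact_Icc.reProdIm isCompact_Icc

/-- Every point is equivalent modulo the lattice to one in the fundamental domain. -/
lemma exists_mem_unitCell {n : ℕ} (z : Fin n → ℂ) :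
    ∃ y ∈ unitCell n, ∀ ψ : (Fin n → ℂ) → ℝ, SpacePeriodic ψ → ψ y = ψ z := by
  refine ⟨fun p => z p + ((-⌊(z p).re⌋ : ℤ) : ℂ) + ((-⌊(z p).im⌋ : ℤ) : ℂ) * Complex.I, ?_,
    fun ψ hψ => hψ z _ _⟩
  intro p _
  rw [Complex.mem_reProdIm]
  have h1 := Int.floor_le (z p).re
  have h2 := Int.lt_floor_add_one (z p).re
  have h3 := Int.floor_le (z p).im
  have h4 := Int.lt_floor_add_one (z p).im
  constructor <;> constructor <;> simp <;> linarith

/-- Barrier form of the parabolic maximum principle on the torus. -/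
lemma lt_barrier_of_touching {n : ℕ} {τ a b : ℝ} {w : ℝ → (Fin n → ℂ) → ℝ}
    (hw : ContinuousOn (fun p : ℝ × (Fin n → ℂ) => w p.1 p.2) (Icc 0 τ ×ˢ univ))
    (hper : ∀ t ∈ Icc 0 τ, SpacePeriodic (w t)) (h0 : ∀ z, w 0 z < a)
    (h : ∀ t ∈ Ioc 0 τ, ∀ z, w t z = a + b * t → (∀ y, w t y ≤ w t z) →
      ∃ d < b, HasDerivWithinAt (fun s => w s z) d (Icc 0 τ) t) :
    ∀ t ∈ Icc 0 τ, ∀ z, w t z < a + b * t := by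
  by_contra! hcon
  obtain ⟨t₁, ht₁, z₁, hz₁⟩ := hcon
  set D : Set (ℝ × (Fin n → ℂ)) := Icc 0 τ ×ˢ unitCell n
  have hDc : IsCompact D := isCompact_Icc.prod (isCompact_unitCell n)
  have hcont : ContinuousOn (fun p : ℝ × (Fin n → ℂ) => w p.1 p.2 - (a + b * p.1)) D :=
    (hw.mono (prod_mono_right (subset_univ _))).sub (by fun_prop)
  set B : Set (ℝ × (Fin n → ℂ)) :=
    D ∩ (fun p : ℝ × (Fin n → ℂ) => w p.1 p.2 - (a + b * p.1)) ⁻¹' Ici 0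
  have hBc : IsCompact B :=
    hDc.of_isClosed_subset (hcont.preimage_isClosed_of_isClosed hDc.isClosed isClosed_Ici)
      inter_subset_left
  have hmemB : ∀ t ∈ Icc 0 τ, ∀ z, a + b * t ≤ w t z → t ∈ Prod.fst '' B := by
    intro t ht z hz
    obtain ⟨y, hy, hψ⟩ := exists_mem_unitCell z
    refine ⟨(t, y), ⟨⟨ht, hy⟩, ?_⟩, rfl⟩
    simp only [mem_preimage, mem_Ici, hψ _ (hper t ht)]
    linarith
  obtain ⟨t, ⟨⟨_, z⟩, ⟨⟨ht, -⟩, hz⟩, rfl⟩, hleast⟩ :=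
    (hBc.image continuous_fst).exists_isLeast ⟨t₁, hmemB t₁ ht₁ z₁ hz₁⟩
  rename_i t
  simp only [mem_preimage, mem_Ici] at hz ht hleast
  have hbefore : ∀ s ∈ Ico 0 t, ∀ y, w s y < a + b * s := by
    intro s hs y
    by_contra! hsy
    exact absurd (hleast (hmemB s ⟨hs.1, hs.2.le.trans ht.2⟩ y hsy)) (not_le.2 hs.2)
  have htpos : 0 < t := by
    rcases ht.1.eq_or_lt with h' | h'
    · subst h'
      have := h0 z
      linarith
    · exact h'
  have : (𝓝[Ico 0 t] t).NeBot := by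
    rw [nhdsWithin_Ico_eq_nhdsLT htpos]
    infer_instance
  have hsub : Ico 0 t ⊆ Icc 0 τ := fun s hs => ⟨hs.1, hs.2.le.trans ht.2⟩
  have hle : ∀ y, w t y ≤ a + b * t := by
    intro y
    have hc : ContinuousOn (fun s => w s y) (Icc 0 τ) :=
      hw.comp (f := fun s : ℝ => (s, y)) (by fun_prop) fun s hs => ⟨hs, mem_univ _⟩
    have h1 : Tendsto (fun s => w s y) (𝓝[Ico 0 t] t) (𝓝 (w t y)) := (hc t ht).mono hsub
    have h2 : Tendsto (fun s => a + b * s) (𝓝[Ico 0 t] t) (𝓝 (a + b * t)) :=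
      Continuous.tendsto' (by fun_prop) _ _ rfl |>.mono_left nhdsWithin_le_nhds
    refine le_of_tendsto_of_tendsto h1 h2 ?_
    filter_upwards [self_mem_nhdsWithin] with s hs using (hbefore s hs y).le
  have heq : w t z = a + b * t := le_antisymm (hle z) (by linarith)
  obtain ⟨d, hd, hderiv⟩ := h t ⟨htpos, ht.2⟩ z heq fun y => heq ▸ hle y
  have hslope := (hasDerivWithinAt_iff_tendsto_slope' (by simp)).1 (hderiv.mono hsub)
  refine hd.not_ge (ge_of_tendsto hslope ?_)
  filter_upwards [self_mem_nhdsWithin] with s hs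
  have h1 := hbefore s hs z
  have h2 : s - t < 0 := sub_neg.2 hs.2
  rw [slope_def_field, le_div_iff_of_neg h2]
  linarith

/-- A periodic family of potentials of Kähler metrics with time derivative `du`. -/
structure KahlerFamily {n : ℕ} (τ : ℝ) (u du : ℝ → (Fin n → ℂ) → ℝ) : Prop where
  continuousOn : ContinuousOn (fun p : ℝ × (Fin n → ℂ) => u p.1 p.2) (Icc 0 τ ×ˢ univ)
  periodic : ∀ t ∈ Icc 0 τ, SpacePeriodic (u t)
  contDiff : ∀ t ∈ Icc 0 τ, ContDiff ℝ 2 (u t)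
  posDef : ∀ t ∈ Icc 0 τ, ∀ z, ((1 : Matrix (Fin n) (Fin n) ℂ) + complexHessian (u t) z).PosDef
  hasDerivWithinAt : ∀ t ∈ Icc 0 τ, ∀ z,
    HasDerivWithinAt (fun s => u s z) (du t z) (Icc 0 τ) t

namespace KahlerFamily

variable {n : ℕ} {τ : ℝ} {u du v dv : ℝ → (Fin n → ℂ) → ℝ}

lemma sub_lt_barrier (hu : KahlerFamily τ u du) (hv : KahlerFamily τ v dv) {a b : ℝ}
    (h0 : ∀ z, u 0 z - v 0 z < a)
    (h : ∀ t ∈ Icc 0 τ, ∀ z, u t z - v t z = a + b * t → logMA (u t) z ≤ logMA (v t) z →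
      du t z - dv t z < b) :
    ∀ t ∈ Icc 0 τ, ∀ z, u t z - v t z < a + b * t := by
  refine lt_barrier_of_touching (w := fun t z => u t z - v t z)
    (hu.continuousOn.sub hv.continuousOn) ?_ h0 ?_
  · intro t ht z α β
    simp only
    rw [hu.periodic t ht, hv.periodic t ht]
  · intro t ht z hz hmax
    have ht' : t ∈ Icc 0 τ := ⟨ht.1.le, ht.2⟩
    refine ⟨_, h t ht' z hz ?_, (hu.hasDerivWithinAt t ht' z).sub (hv.hasDerivWithinAt t ht' z)⟩
    exact logMA_le_logMA (hu.contDiff t ht') (hv.contDiff t ht') (hu.posDef t ht' z)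
      (Eventually.of_forall hmax)

lemma mono (hu : KahlerFamily τ u du) {σ : ℝ} (h : σ ≤ τ) : KahlerFamily σ u du := by
  have hsub : Icc 0 σ ⊆ Icc 0 τ := Icc_subset_Icc_right h
  exact ⟨hu.continuousOn.mono (prod_mono_left hsub), fun t ht => hu.periodic t (hsub ht),
    fun t ht => hu.contDiff t (hsub ht), fun t ht => hu.posDef t (hsub ht),
    fun t ht z => (hu.hasDerivWithinAt t (hsub ht) z).mono hsub⟩

/-- Translation in time. -/
lemma shift (hu : KahlerFamily τ u du) {r : ℝ} (hr : 0 ≤ r) :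
    KahlerFamily (τ - r) (fun t => u (t + r)) (fun t => du (t + r)) := by
  have hmem : ∀ t ∈ Icc 0 (τ - r), t + r ∈ Icc 0 τ := fun t ht =>
    ⟨by linarith [ht.1], by linarith [ht.2]⟩
  refine ⟨?_, fun t ht => hu.periodic _ (hmem t ht), fun t ht => hu.contDiff _ (hmem t ht),
    fun t ht => hu.posDef _ (hmem t ht), fun t ht z => ?_⟩
  · exact hu.continuousOn.comp (f := fun p : ℝ × (Fin n → ℂ) => (p.1 + r, p.2)) (by fun_prop)
      fun p hp => ⟨hmem _ hp.1, mem_univ _⟩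
  · have h := (hu.hasDerivWithinAt _ (hmem t ht) z).comp t
      ((hasDerivWithinAt_id t (Icc 0 (τ - r))).add_const r) fun s hs => hmem s hs
    rwa [mul_one] at h

lemma const {ψ : (Fin n → ℂ) → ℝ} (τ : ℝ) (hper : SpacePeriodic ψ) (hψ : ContDiff ℝ 2 ψ)
    (hpos : ∀ z, ((1 : Matrix (Fin n) (Fin n) ℂ) + complexHessian ψ z).PosDef) :
    KahlerFamily τ (fun _ => ψ) (fun _ _ => 0) :=
  ⟨(hψ.continuous.comp continuous_snd).continuousOn, fun _ _ => hper, fun _ _ => hψ,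
    fun _ _ => hpos, fun _ _ _ => hasDerivWithinAt_const _ _ _⟩

lemma complexHessian_zero (z : Fin n → ℂ) : complexHessian (fun _ => (0 : ℝ)) z = 0 := by
  have hx : ∀ p : Fin n, pdx p (fun _ => (0 : ℝ)) = fun _ => 0 := fun p => by ext; simp [pdx]
  have hy : ∀ p : Fin n, pdy p (fun _ => (0 : ℝ)) = fun _ => 0 := fun p => by ext; simp [pdy]
  ext p q
  simp [complexHessian, hx, hy]

lemma zero (τ : ℝ) : KahlerFamily (n := n) τ (fun _ _ => 0) (fun _ _ => 0) :=
  const τ (fun _ _ _ => rfl) contDiff_const fun z => by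
    rw [complexHessian_zero, add_zero]
    exact Matrix.PosDef.one

lemma logMA_zero (z : Fin n → ℂ) : logMA (fun _ => (0 : ℝ)) z = 0 := by
  simp [logMA, complexHessian_zero]

end KahlerFamily

lemma IsMAFlowSolution.kahlerFamily {n : ℕ} {F : ℝ → (Fin n → ℂ) → ℝ} {T : ℝ}
    {φ : ℝ → (Fin n → ℂ) → ℝ} (h : IsMAFlowSolution F 1 T φ) :
    KahlerFamily T φ fun t z => logMA (φ t) z + F (φ t z) z := by
  obtain ⟨hsm, hper, hpos, hder⟩ := h
  refine ⟨hsm.continuousOn, hper, fun t ht => ?_, hpos, fun t ht z => ?_⟩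
  · have h1 : ContDiffOn ℝ (⊤ : ℕ∞) (fun z => φ t z) univ :=
      hsm.comp (f := fun z : Fin n → ℂ => (t, z)) (by fun_prop) fun z _ => ⟨ht, mem_univ _⟩
    exact contDiff_infty.1 (contDiffOn_univ.1 h1) 2
  · simpa [logMA] using hder t ht z

/-- A `C¹` periodic nonlinearity is bounded and uniformly Lipschitz for bounded values of its
first argument. -/
lemma exists_bound_and_lipschitz {n : ℕ} {F : ℝ → (Fin n → ℂ) → ℝ}
    (hF : ContDiff ℝ 1 (fun p : ℝ × (Fin n → ℂ) => F p.1 p.2))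
    (hFper : ∀ s : ℝ, SpacePeriodic (F s)) (M : ℝ) :
    ∃ B ≥ (1 : ℝ), ∃ K ≥ (1 : ℝ), (∀ s ∈ Icc (-M) M, ∀ z, |F s z| < B) ∧
      ∀ s ∈ Icc (-M) M, ∀ r ∈ Icc (-M) M, ∀ z, |F s z - F r z| ≤ K * |s - r| := by
  have hDc : IsCompact (Icc (-M) M ×ˢ unitCell n) := isCompact_Icc.prod (isCompact_unitCell n)
  obtain ⟨B, hB⟩ := hDc.exists_bound_of_continuousOn hF.continuous.continuousOn
  obtain ⟨K, hK⟩ := hF.locallyLipschitz.locallyLipschitzOn.exists_lipschitzOnWith_of_compact hDc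
  refine ⟨max 1 (B + 1), le_max_left _ _, max 1 K, le_max_left _ _, ?_, ?_⟩
  · intro s hs z
    obtain ⟨y, hy, hψ⟩ := exists_mem_unitCell z
    have h := hB (s, y) ⟨hs, hy⟩
    rw [Real.norm_eq_abs, hψ _ (hFper s)] at h
    exact lt_max_of_lt_right (by linarith)
  · intro s hs r hr z
    obtain ⟨y, hy, hψ⟩ := exists_mem_unitCell z
    have h := hK.dist_le_mul (s, y) ⟨hs, hy⟩ (r, y) ⟨hr, hy⟩
    simp only [hψ _ (hFper s), hψ _ (hFper r), Real.dist_eq, Prod.dist_eq, dist_self] at h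
    rw [max_eq_left (abs_nonneg _)] at h
    exact h.trans (by gcongr; exact le_max_right _ _)

lemma HasDerivWithinAt.abs_le_of_lipschitz {f : ℝ → ℝ} {d L τ t : ℝ} (hτ : 0 < τ)
    (ht : t ∈ Icc 0 τ) (hd : HasDerivWithinAt f d (Icc 0 τ) t)
    (hL : ∀ s ∈ Icc 0 τ, |f s - f t| ≤ L * |s - t|) : |d| ≤ L := by
  have : (𝓝[Icc 0 τ \ {t}] t).NeBot := by
    rw [← accPt_principal_iff_nhdsWithin, ← uniqueDiffWithinAt_iff_accPt]
    exact uniqueDiffOn_Icc hτ t ht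
  refine le_of_tendsto (hasDerivWithinAt_iff_tendsto_slope.1 hd).abs ?_
  filter_upwards [self_mem_nhdsWithin] with s hs
  have hne : 0 < |s - t| := abs_pos.2 (sub_ne_zero.2 hs.2)
  rw [slope_def_field, abs_div, div_le_iff₀ hne]
  exact hL s hs.1

namespace KahlerFamily

variable {n : ℕ} {F : ℝ → (Fin n → ℂ) → ℝ} {φ : ℝ → (Fin n → ℂ) → ℝ} {τ : ℝ}

/-- Short-time sup bound along the flow. -/
lemma mem_Icc (hφ : KahlerFamily τ φ fun t z => logMA (φ t) z + F (φ t z) z) {A B : ℝ}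
    (hBτ : B * τ ≤ 1) (hB : ∀ s ∈ Icc (-(A + 2)) (A + 2), ∀ z, |F s z| < B)
    (h0 : ∀ z, |φ 0 z| ≤ A) :
    ∀ t ∈ Icc 0 τ, ∀ z, φ t z ∈ Icc (-(A + 2)) (A + 2) := by
  intro t ht z
  have hA : 0 ≤ A := (abs_nonneg _).trans (h0 z)
  have hB0 : 0 ≤ B := (abs_nonneg _).trans (hB 0 ⟨by linarith, by linarith⟩ z).le
  have hbar : ∀ s ∈ Icc 0 τ, 0 ≤ B * s ∧ B * s ≤ 1 := fun s hs =>
    ⟨mul_nonneg hB0 hs.1, (mul_le_mul_of_nonneg_left hs.2 hB0).trans hBτ⟩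
  have hup := hφ.sub_lt_barrier (zero τ) (a := A + 1) (b := B)
    (fun y => by linarith [le_abs_self (φ 0 y), h0 y]) (fun s hs y hy hL => by
      rw [logMA_zero] at hL
      have h1 := hbar s hs
      have h2 := (abs_lt.1 (hB (φ s y) ⟨by linarith, by linarith⟩ y)).2
      linarith) t ht z
  have hlow := (zero τ).sub_lt_barrier hφ (a := A + 1) (b := B)
    (fun y => by linarith [neg_abs_le (φ 0 y), h0 y]) (fun s hs y hy hL => by
      rw [logMA_zero] at hL
      have h1 := hbar s hs
      have h2 := (abs_lt.1 (hB (φ s y) ⟨by linarith, by linarith⟩ y)).1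
      linarith) t ht z
  have h1 := hbar t ht
  exact ⟨by linarith, by linarith⟩

/-- Short-time Lipschitz bound in time along the flow, obtained by comparing the flow with its
time translates. -/
lemma lipschitz_in_time (hφ : KahlerFamily τ φ fun t z => logMA (φ t) z + F (φ t z) z)
    {A K M : ℝ} (hA : 0 ≤ A) (hK1 : 1 ≤ K) (hKτ : 4 * (K * (A + 1 + 1) * τ) ≤ 1)
    (hM : ∀ t ∈ Icc 0 τ, ∀ z, φ t z ∈ Icc (-M) M)
    (hK : ∀ s ∈ Icc (-M) M, ∀ r ∈ Icc (-M) M, ∀ z, |F s z - F r z| ≤ K * |s - r|)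
    (h0 : ∀ z, |logMA (φ 0) z + F (φ 0 z) z| ≤ A) :
    ∀ s ∈ Icc 0 τ, ∀ r ∈ Icc 0 τ, ∀ z, |φ s z - φ r z| ≤ 2 * (A + 1 + 1) * |s - r| := by
  suffices H : ∀ h > 0, ∀ t, 0 ≤ t → t + h ≤ τ → ∀ z,
      |φ (t + h) z - φ t z| ≤ 2 * (A + 1 + 1) * h by
    intro s hs r hr z
    rcases lt_trichotomy s r with hsr | rfl | hsr
    · have h := H (r - s) (sub_pos.2 hsr) s hs.1 (by linarith [hr.2]) z
      rwa [add_sub_cancel, abs_sub_comm, ← abs_of_pos (sub_pos.2 hsr), abs_sub_comm r s] at h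
    · simp
    · have h := H (s - r) (sub_pos.2 hsr) r hr.1 (by linarith [hs.2]) z
      rwa [add_sub_cancel, ← abs_of_pos (sub_pos.2 hsr)] at h
  intro h hh t ht hth z
  have hτ : 0 ≤ τ := by linarith
  have hhτ : h ∈ Icc 0 τ := ⟨hh.le, by linarith⟩
  have h0τ : (0 : ℝ) ∈ Icc 0 τ := ⟨le_rfl, hτ⟩
  have hsmall : ∀ s ∈ Icc 0 τ, 4 * (K * (h + (A + 1) * s)) ≤ 1 := fun s hs => by
    refine le_trans ?_ hKτ
    have : h + (A + 1) * s ≤ (A + 1 + 1) * τ := by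
      have := mul_le_mul_of_nonneg_left hs.2 (by linarith : 0 ≤ A + 1)
      linarith [hhτ.2]
    have := mul_le_mul_of_nonneg_left this (by linarith : 0 ≤ K)
    linarith
  have hFle : ∀ s ∈ Icc 0 τ, ∀ r ∈ Icc 0 τ, ∀ y d, φ s y - φ r y = d → 0 ≤ d →
      F (φ s y) y - F (φ r y) y ≤ K * d ∧ F (φ r y) y - F (φ s y) y ≤ K * d := by
    intro s hs r hr y d hd hd0
    have h1 := hK _ (hM s hs y) _ (hM r hr y) y
    rw [hd, abs_of_nonneg hd0] at h1
    exact ⟨(le_abs_self _).trans h1, by linarith [neg_abs_le (F (φ s y) y - F (φ r y) y)]⟩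
  have hinit : ∀ y, |φ h y - φ 0 y| < (A + 1 + 1) * h := by
    have hconst : KahlerFamily τ (fun _ => φ 0) fun _ _ => 0 :=
      const τ (hφ.periodic 0 h0τ) (hφ.contDiff 0 h0τ) (hφ.posDef 0 h0τ)
    intro y
    have hup := hφ.sub_lt_barrier hconst (a := h) (b := A + 1) (fun y => by linarith)
      (fun s hs y hy hL => by
        have hd0 : 0 ≤ h + (A + 1) * s := add_nonneg hh.le (mul_nonneg (by linarith) hs.1)
        have h1 := (hFle s hs 0 h0τ y _ hy hd0).1
        have h2 := hsmall s hs
        have h3 := (abs_le.1 (h0 y)).2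
        linarith) h hhτ y
    have hlow := hconst.sub_lt_barrier hφ (a := h) (b := A + 1) (fun y => by linarith)
      (fun s hs y hy hL => by
        have hd0 : 0 ≤ h + (A + 1) * s := add_nonneg hh.le (mul_nonneg (by linarith) hs.1)
        have h1 := (hFle 0 h0τ s hs y _ hy hd0).1
        have h2 := hsmall s hs
        have h3 := (abs_le.1 (h0 y)).1
        linarith) h hhτ y
    exact abs_lt.2 ⟨by linarith, by linarith⟩
  set a : ℝ := (A + 1 + 1) * h with ha
  have ha0 : 0 < a := by positivity
  have hKt : ∀ s ∈ Icc 0 τ, 4 * (K * s) ≤ 1 := fun s hs => by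
    refine le_trans ?_ hKτ
    have h1 : s ≤ (A + 1 + 1) * τ := by nlinarith [hs.2, mul_nonneg hA hτ]
    have := mul_le_mul_of_nonneg_left h1 (by linarith : 0 ≤ K)
    linarith
  have hmem : ∀ s ∈ Icc 0 (τ - h), s ∈ Icc 0 τ ∧ s + h ∈ Icc 0 τ := fun s hs =>
    ⟨⟨hs.1, by linarith [hs.2]⟩, ⟨by linarith [hs.1], by linarith [hs.2]⟩⟩
  have hstep : ∀ s ∈ Icc 0 τ, 0 ≤ a + 2 * K * a * s ∧ K * (a + 2 * K * a * s) < 2 * K * a := by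
    intro s hs
    have h1 := hs.1
    have h2 := hKt s hs
    have hKa : 0 < K * a := by positivity
    refine ⟨by positivity, ?_⟩
    have := mul_le_mul_of_nonneg_left h2 hKa.le
    nlinarith
  have hu := hφ.shift hh.le
  have hv := hφ.mono (show τ - h ≤ τ by linarith)
  have htm : t ∈ Icc 0 (τ - h) := ⟨ht, by linarith⟩
  have hup := hu.sub_lt_barrier hv (a := a) (b := 2 * K * a)
    (fun y => by simpa using (abs_lt.1 (hinit y)).2)
    (fun s hs y hy hL => by
      have hm := hmem s hs
      have h1 := hstep s hm.1
      have h2 := (hFle _ hm.2 _ hm.1 y _ hy h1.1).1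
      linarith) t htm z
  have hlow := hv.sub_lt_barrier hu (a := a) (b := 2 * K * a)
    (fun y => by simpa using (abs_lt.1 ((abs_sub_comm _ _).trans_lt (hinit y))).2)
    (fun s hs y hy hL => by
      have hm := hmem s hs
      have h1 := hstep s hm.1
      have h2 := (hFle _ hm.1 _ hm.2 y _ hy h1.1).1
      linarith) t htm z
  have hfin : a + 2 * K * a * t ≤ 2 * a := by
    have := mul_le_mul_of_nonneg_left (hKt t (hmem t htm).1) ha0.le
    linarith
  rw [mul_assoc, ← ha]
  exact abs_le.2 ⟨by linarith, by linarith⟩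

end KahlerFamily

/-- Lemma 2.1 of the paper, flat torus case: given smooth `F`, periodic in
the space variable, and bounds `A₀, A₁`, there exist `T > 0` and `C > 0` depending only
on `F, A₀, A₁` such that any solution `φ` of the flow
`∂φ/∂t = log det(Iₙ + H(φ)) + F(φ,z)` on `[0,T']` with `sup|φ(0,·)| ≤ A₀` and
`sup|φ̇(0,·)| ≤ A₁` satisfies `|φ| ≤ C`, `|φ̇| ≤ C` and `|log det(Iₙ + H(φ))| ≤ C`
on `[0, min T T'] × ℂⁿ`.  (Along the flow, `φ̇(t,z) = log det(Iₙ + H(φ(t,·)))(z) + F(φ(t,z),z)`.) -/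
theorem stmt8 (n : ℕ) (F : ℝ → (Fin n → ℂ) → ℝ)
    (hF : ContDiff ℝ (⊤ : ℕ∞) (fun p : ℝ × (Fin n → ℂ) => F p.1 p.2))
    (hFper : ∀ s : ℝ, SpacePeriodic (F s))
    (A₀ A₁ : ℝ) (hA₀ : 0 < A₀) (hA₁ : 0 < A₁) :
    ∃ T > (0 : ℝ), ∃ C > (0 : ℝ), ∀ T' > (0 : ℝ), ∀ φ : ℝ → (Fin n → ℂ) → ℝ,
      IsMAFlowSolution F 1 T' φ →
      (∀ z, |φ 0 z| ≤ A₀) →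
      (∀ z, |Real.log (((1 : Matrix (Fin n) (Fin n) ℂ)
          + complexHessian (φ 0) z).det.re) + F (φ 0 z) z| ≤ A₁) →
      ∀ t ∈ Icc 0 (min T T'), ∀ z,
        |φ t z| ≤ C ∧
        |Real.log (((1 : Matrix (Fin n) (Fin n) ℂ)
          + complexHessian (φ t) z).det.re) + F (φ t z) z| ≤ C ∧
        |Real.log (((1 : Matrix (Fin n) (Fin n) ℂ)
          + complexHessian (φ t) z).det.re)| ≤ C := by
  obtain ⟨B, hB1, K, hK1, hB, hK⟩ :=
    exists_bound_and_lipschitz (hF.of_le (by exact_mod_cast le_top)) hFper (A₀ + 2)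
  set c : ℝ := A₁ + 1 with hc
  have hT0 : 0 < 1 / B := by positivity
  have hT1 : 0 < 1 / (4 * K * (c + 1)) := by positivity
  refine ⟨min (1 / B) (1 / (4 * K * (c + 1))), lt_min hT0 hT1,
    A₀ + 2 + 2 * (c + 1) + B, by positivity, ?_⟩
  intro T' hT' φ hφ hφ0 hφ1 t ht z
  set τ := min (min (1 / B) (1 / (4 * K * (c + 1)))) T' with hτ
  have hτpos : 0 < τ := lt_min (lt_min hT0 hT1) hT'
  have hBτ : B * τ ≤ 1 := by
    have h := (min_le_left _ T').trans (min_le_left (1 / B) (1 / (4 * K * (c + 1))))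
    rw [← hτ, le_div_iff₀ (by positivity)] at h
    linarith
  have hKτ : 4 * (K * (c + 1) * τ) ≤ 1 := by
    have h := (min_le_left _ T').trans (min_le_right (1 / B) (1 / (4 * K * (c + 1))))
    rw [← hτ, le_div_iff₀ (by positivity)] at h
    linarith
  have hfam := hφ.kahlerFamily.mono (min_le_right _ T' : τ ≤ T')
  have hbound : ∀ s ∈ Icc 0 τ, ∀ y, φ s y ∈ Icc (-(A₀ + 2)) (A₀ + 2) :=
    hfam.mem_Icc hBτ hB hφ0
  have hlip : ∀ s ∈ Icc 0 τ, ∀ r ∈ Icc 0 τ, ∀ y, |φ s y - φ r y| ≤ 2 * (c + 1) * |s - r| :=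
    hfam.lipschitz_in_time hA₁.le hK1 hKτ hbound hK hφ1
  have hder := (hfam.hasDerivWithinAt t ht z).abs_le_of_lipschitz hτpos ht
    fun s hs => hlip s hs t ht z
  have hφt := abs_le.2 (hbound t ht z)
  have hFt := hB _ (hbound t ht z) z
  have hc0 : 0 < c + 1 := by positivity
  change |φ t z| ≤ _ ∧ |logMA (φ t) z + F (φ t z) z| ≤ _ ∧ |logMA (φ t) z| ≤ _
  refine ⟨by linarith, by linarith, ?_⟩
  have h := abs_sub (logMA (φ t) z + F (φ t z) z) (F (φ t z) z)
  rw [add_sub_cancel_right] at h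
  linarith

end
end

section
/- Let F : ℝ × ℂⁿ → ℝ be smooth and periodic in the second variable, let T > 0, and let φ be a solution on [0,T] of the parabolic complex Monge–Ampère flow ∂φ/∂t = log det(Iₙ + H(φ(t,·))) + F(φ, z) satisfying |φ(t,z)| ≤ C₀ and |∂φ/∂t(t,z)| ≤ C₀ on [0,T] × ℂⁿ for some C₀ > 0. Then there exists C > 0 depending only on F, C₀ and T such that the squared Euclidean gradient of φ(t,·) (the gradient in all 2n real space variables) satisfies |∇φ(t,z)|² ≤ e^{C/t} for all t ∈ (0,T] and all z ∈ ℂⁿ. -/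
open Set Filter Topology
open scoped ComplexOrder

noncomputable section

/-- The squared Euclidean gradient of `ψ : ℂⁿ → ℝ` in all `2n` real space variables. -/
def gradSq {n : ℕ} (ψ : (Fin n → ℂ) → ℝ) (z : Fin n → ℂ) : ℝ :=
  ∑ p : Fin n, ((pdx p ψ z) ^ 2 + (pdy p ψ z) ^ 2)

/-- The sesquilinear form obtained as the `(1,1)`-part of a real bilinear form `B` on `ℂⁿ`. -/
def leviForm {n : ℕ} (B : (Fin n → ℂ) →L[ℝ] (Fin n → ℂ) →L[ℝ] ℝ) (a c : Fin n → ℂ) : ℂ :=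
  (1 / 4 : ℂ) * ((B a c + B (Complex.I • a) (Complex.I • c) : ℝ) : ℂ) +
    (Complex.I / 4) * ((B a (Complex.I • c) - B (Complex.I • a) c : ℝ) : ℂ)

theorem complex_smul_eq {n : ℕ} (w : ℂ) (a : Fin n → ℂ) :
    w • a = w.re • a + w.im • (Complex.I • a) := by
  ext p
  simp only [Pi.smul_apply, Pi.add_apply, smul_eq_mul, Complex.real_smul]
  nth_rewrite 1 [← Complex.re_add_im w]
  ring

theorem leviForm_smul_left {n : ℕ} (B : (Fin n → ℂ) →L[ℝ] (Fin n → ℂ) →L[ℝ] ℝ) (w : ℂ)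
    (a c : Fin n → ℂ) : leviForm B (w • a) c = w * leviForm B a c := by
  have hI : Complex.I • w • a = w.re • (Complex.I • a) - w.im • a := by
    rw [complex_smul_eq w a, smul_add, smul_comm Complex.I w.re, smul_comm Complex.I w.im,
      smul_smul Complex.I Complex.I, Complex.I_mul_I]
    simp [sub_eq_add_neg]
  unfold leviForm
  rw [hI, complex_smul_eq w a]
  nth_rewrite 9 [← Complex.re_add_im w]
  simp only [map_add, map_sub, map_smul, add_apply,
    sub_apply, smul_apply, smul_eq_mul]
  push_cast
  ring_nf
  simp only [Complex.I_sq]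
  ring

theorem leviForm_smul_right {n : ℕ} (B : (Fin n → ℂ) →L[ℝ] (Fin n → ℂ) →L[ℝ] ℝ) (w : ℂ)
    (a c : Fin n → ℂ) : leviForm B a (w • c) = star w * leviForm B a c := by
  have hI : Complex.I • w • c = w.re • (Complex.I • c) - w.im • c := by
    rw [complex_smul_eq w c, smul_add, smul_comm Complex.I w.re, smul_comm Complex.I w.im,
      smul_smul Complex.I Complex.I, Complex.I_mul_I]
    simp [sub_eq_add_neg]
  have hw : star w = (w.re : ℂ) - w.im * Complex.I := by
    apply Complex.ext <;> simp
  unfold leviForm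
  rw [hI, complex_smul_eq w c, hw]
  simp only [map_add, map_sub, map_smul, smul_eq_mul]
  push_cast
  ring_nf
  simp only [Complex.I_sq]
  ring

theorem leviForm_sum_left {n : ℕ} {ι : Type*} (B : (Fin n → ℂ) →L[ℝ] (Fin n → ℂ) →L[ℝ] ℝ)
    (s : Finset ι) (a : ι → Fin n → ℂ) (c : Fin n → ℂ) :
    leviForm B (∑ i ∈ s, a i) c = ∑ i ∈ s, leviForm B (a i) c := by
  unfold leviForm
  simp only [Finset.smul_sum, map_sum, sum_apply]
  push_cast
  simp only [Finset.sum_add_distrib, Finset.mul_sum, mul_add, mul_sub, Finset.sum_sub_distrib]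

theorem leviForm_sum_right {n : ℕ} {ι : Type*} (B : (Fin n → ℂ) →L[ℝ] (Fin n → ℂ) →L[ℝ] ℝ)
    (s : Finset ι) (a : Fin n → ℂ) (c : ι → Fin n → ℂ) :
    leviForm B a (∑ i ∈ s, c i) = ∑ i ∈ s, leviForm B a (c i) := by
  unfold leviForm
  simp only [Finset.smul_sum, map_sum]
  push_cast
  simp only [Finset.sum_add_distrib, Finset.mul_sum, mul_add, mul_sub, Finset.sum_sub_distrib]

theorem leviForm_eq_sum {n : ℕ} (B : (Fin n → ℂ) →L[ℝ] (Fin n → ℂ) →L[ℝ] ℝ)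
    (a c : Fin n → ℂ) :
    leviForm B a c =
      ∑ p, ∑ q, a p * star (c q) * leviForm B (Pi.single p 1) (Pi.single q 1) := by
  conv_lhs => rw [pi_eq_sum_univ' a, pi_eq_sum_univ' c]
  rw [leviForm_sum_left]
  refine Finset.sum_congr rfl fun p _ => ?_
  rw [leviForm_sum_right]
  refine Finset.sum_congr rfl fun q _ => ?_
  rw [leviForm_smul_left, leviForm_smul_right]
  ring

theorem exists_unitary_diagonalization {n : ℕ} {g : Matrix (Fin n) (Fin n) ℂ} (hg : g.PosDef) :
    ∃ (U : Matrix (Fin n) (Fin n) ℂ) (lam : Fin n → ℝ), U.conjTranspose * U = 1 ∧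
      U * U.conjTranspose = 1 ∧ (∀ m, 0 < lam m) ∧
      U.conjTranspose * g * U = Matrix.diagonal (fun m => (lam m : ℂ)) := by
  refine ⟨hg.1.eigenvectorUnitary, hg.1.eigenvalues, ?_, ?_, hg.eigenvalues_pos, ?_⟩
  · exact Unitary.coe_star_mul_self _
  · exact Unitary.coe_mul_star_self _
  · have h1 := hg.1.conjStarAlgAut_star_eigenvectorUnitary
    rw [Unitary.conjStarAlgAut_apply] at h1
    simpa [Matrix.star_eq_conjTranspose, Function.comp_def] using h1

theorem sum_sq_unitary_frame {n : ℕ} {U : Matrix (Fin n) (Fin n) ℂ}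
    (hU : U * U.conjTranspose = 1) (L : (Fin n → ℂ) →L[ℝ] ℝ) :
    ∑ m, ((L fun p => star (U p m)) ^ 2 + (L (Complex.I • fun p => star (U p m))) ^ 2) =
      ∑ p, ((L (Pi.single p 1)) ^ 2 + (L (Pi.single p Complex.I)) ^ 2) := by
  set l : (Fin n → ℂ) → ℂ := fun a => (L a : ℂ) - Complex.I * (L (Complex.I • a) : ℂ) with hl
  have hsq (a : Fin n → ℂ) : (((L a) ^ 2 + (L (Complex.I • a)) ^ 2 : ℝ) : ℂ) = l a * star (l a) := by
    simp only [hl]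
    apply Complex.ext
    · simp [pow_two]
    · simp [pow_two]; ring
  have hsmul (w : ℂ) (a : Fin n → ℂ) : l (w • a) = w * l a := by
    have hI : Complex.I • w • a = w.re • (Complex.I • a) - w.im • a := by
      rw [complex_smul_eq w a, smul_add, smul_comm Complex.I w.re, smul_comm Complex.I w.im,
        smul_smul Complex.I Complex.I, Complex.I_mul_I]
      simp [sub_eq_add_neg]
    simp only [hl]
    rw [hI, complex_smul_eq w a]
    apply Complex.ext
    · simp
    · simp; ring
  have hexp (a : Fin n → ℂ) : l a = ∑ p, a p * l (Pi.single p 1) := by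
    have hsum : l a = ∑ p, l (a p • Pi.single p 1) := by
      conv_lhs => rw [pi_eq_sum_univ' a]
      simp only [hl, Finset.smul_sum, map_sum]
      push_cast
      rw [Finset.mul_sum, Finset.sum_sub_distrib]
    rw [hsum]
    exact Finset.sum_congr rfl fun p _ => hsmul _ _
  have hentry (p q : Fin n) : ∑ m, star (U p m) * U q m = if p = q then 1 else 0 := by
    have := congrFun (congrFun hU q) p
    rw [Matrix.mul_apply, Matrix.one_apply] at this
    simp only [Matrix.conjTranspose_apply] at this
    simp only [eq_comm (a := p)]
    rw [← this]
    exact Finset.sum_congr rfl fun m _ => mul_comm _ _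
  have hI (p : Fin n) : (Pi.single p Complex.I : Fin n → ℂ) = Complex.I • Pi.single p 1 := by
    rw [← Pi.single_smul]; simp
  apply Complex.ofReal_injective
  simp only [hI]
  rw [Complex.ofReal_sum, Complex.ofReal_sum]
  simp only [hsq]
  calc ∑ m, l (fun p => star (U p m)) * star (l fun p => star (U p m))
      = ∑ m, ∑ p, ∑ q, (star (U p m) * U q m) *
          (l (Pi.single p 1) * star (l (Pi.single q 1))) := by
        refine Finset.sum_congr rfl fun m _ => ?_
        rw [hexp fun p => star (U p m), star_sum, Finset.sum_mul_sum]
        refine Finset.sum_congr rfl fun p _ => Finset.sum_congr rfl fun q _ => ?_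
        rw [star_mul', star_star]
        ring
    _ = ∑ p, ∑ q, (∑ m, star (U p m) * U q m) *
          (l (Pi.single p 1) * star (l (Pi.single q 1))) := by
        rw [Finset.sum_comm]
        refine Finset.sum_congr rfl fun p _ => ?_
        rw [Finset.sum_comm]
        exact Finset.sum_congr rfl fun q _ => by rw [Finset.sum_mul]
    _ = _ := by simp only [hentry, ite_mul, one_mul, zero_mul, Finset.sum_ite_eq, Finset.mem_univ,
        if_true]

theorem sq_add_sq_sum_le {ι : Type*} (s : Finset ι) (α τ X Y : ι → ℝ) :
    (∑ k ∈ s, (α k * X k + τ k * Y k)) ^ 2 + (∑ k ∈ s, (τ k * X k - α k * Y k)) ^ 2 ≤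
      (∑ k ∈ s, (X k ^ 2 + Y k ^ 2)) * ∑ k ∈ s, (α k ^ 2 + τ k ^ 2) := by
  have hn (x y : ℝ) : ‖(⟨x, y⟩ : ℂ)‖ ^ 2 = x ^ 2 + y ^ 2 := by
    rw [← Complex.normSq_eq_norm_sq, Complex.normSq_mk]; ring
  have h1 : ‖∑ k ∈ s, (⟨α k, τ k⟩ : ℂ) * ⟨X k, -Y k⟩‖ ^ 2 ≤
      (∑ k ∈ s, ‖(⟨α k, τ k⟩ : ℂ)‖ ^ 2) * ∑ k ∈ s, ‖(⟨X k, -Y k⟩ : ℂ)‖ ^ 2 := by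
    refine le_trans ?_ (Finset.sum_mul_sq_le_sq_mul_sq s _ _)
    refine pow_le_pow_left₀ (norm_nonneg _) ?_ 2
    refine (norm_sum_le _ _).trans (le_of_eq ?_)
    simp
  have h2 : ∑ k ∈ s, (⟨α k, τ k⟩ : ℂ) * ⟨X k, -Y k⟩ =
      ⟨∑ k ∈ s, (α k * X k + τ k * Y k), ∑ k ∈ s, (τ k * X k - α k * Y k)⟩ := by
    apply Complex.ext
    · simp
    · simp only [Complex.im_sum, Complex.mul_im]
      exact Finset.sum_congr rfl fun _ _ => by ring
  rw [h2, hn] at h1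
  simp only [hn, neg_sq] at h1
  linarith [mul_comm (∑ k ∈ s, (α k ^ 2 + τ k ^ 2)) (∑ k ∈ s, (X k ^ 2 + Y k ^ 2))]

/-- Cauchy–Schwarz for the part of a real Hessian complementary to its `(1,1)`-part, at a point
where the gradient of `|∇u|²` is proportional to `∇u`. -/
theorem hessian_row_estimate {ι : Type*} [Fintype ι] [DecidableEq ι] (m : ι)
    (X Y a t a' t' : ι → ℝ) (c κ : ℝ) (ht : ∀ k, t' k = t k)
    (ha : ∀ k, a k + a' k = if k = m then 2 * c else 0)
    (hP : ∑ k, (X k * a k + Y k * t k) = κ * X m)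
    (hQ : ∑ k, (X k * t' k + Y k * a' k) = κ * Y m) :
    (κ * X m) ^ 2 + (κ * Y m) ^ 2 ≤
      (∑ k, (X k ^ 2 + Y k ^ 2)) *
        ((∑ k, (a k ^ 2 + t k ^ 2) + ∑ k, (t' k ^ 2 + a' k ^ 2)) / 2) +
      2 * c * κ * (X m ^ 2 + Y m ^ 2) := by
  set δ : ι → ℝ := fun k => if k = m then c else 0 with hδ
  have hδX (Z : ι → ℝ) : ∑ k, δ k * Z k = c * Z m := by simp [hδ]
  have ha' (k) : a' k = 2 * δ k - a k := by
    have := ha k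
    by_cases hk : k = m <;> simp [hδ, hk] at this ⊢ <;> linarith
  have h := sq_add_sq_sum_le Finset.univ (fun k => a k - δ k) t X Y
  have h1 : ∑ k, ((a k - δ k) * X k + t k * Y k) = κ * X m - c * X m := by
    rw [← hP, ← hδX, ← Finset.sum_sub_distrib]
    exact Finset.sum_congr rfl fun _ _ => by ring
  have h2 : ∑ k, (t k * X k - (a k - δ k) * Y k) = κ * Y m - c * Y m := by
    rw [← hQ, ← hδX, ← Finset.sum_sub_distrib]
    exact Finset.sum_congr rfl fun k _ => by rw [ha', ht]; ring
  have h3 : ∑ k, ((a k - δ k) ^ 2 + t k ^ 2) ≤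
      (∑ k, (a k ^ 2 + t k ^ 2) + ∑ k, (t' k ^ 2 + a' k ^ 2)) / 2 := by
    rw [← Finset.sum_add_distrib, Finset.sum_div]
    exact Finset.sum_le_sum fun k _ => by rw [ha', ht]; nlinarith [sq_nonneg (δ k)]
  rw [h1, h2] at h
  have h4 := h.trans (mul_le_mul_of_nonneg_left h3
    (Finset.sum_nonneg fun k _ => add_nonneg (sq_nonneg (X k)) (sq_nonneg (Y k))))
  nlinarith [sq_nonneg (c * X m), sq_nonneg (c * Y m)]

/-- The pointwise inequality behind Błocki's gradient estimate at a maximum of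
`t log (1 + |∇u|²) - γ(u)`, in coordinates diagonalizing the metric.  Here `G = γ'(u)`,
`γ'' = -1`, and `ee`, `ef`, `fe`, `ff` are the blocks of the real Hessian of `u`. -/
theorem blocki_pointwise {ι : Type*} [Fintype ι] [DecidableEq ι]
    (lam X Y Fx Fy xt yt : ι → ℝ) (ee ef fe ff Pe Qe Pf Qf : ι → ι → ℝ) (t G ut Fs b : ℝ)
    (hlam : ∀ m, 0 < lam m) (ht : 0 < t) (hG : 0 < G)
    (hb : b = ∑ k, (X k ^ 2 + Y k ^ 2))
    (hef : ∀ m k, fe m k = ef m k)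
    (hlevi : ∀ m k, ee m k + ff m k = if k = m then 4 * (lam m - 1) else 0)
    (hxt : ∀ k, xt k = ∑ m, (lam m)⁻¹ * ((Pe m k + Pf m k) / 4) + (Fs * X k + Fx k))
    (hyt : ∀ k, yt k = ∑ m, (lam m)⁻¹ * ((Qe m k + Qf m k) / 4) + (Fs * Y k + Fy k))
    (he1 : ∀ m, t * (2 * ∑ k, (X k * ee m k + Y k * ef m k)) / (1 + b) = G * X m)
    (hf1 : ∀ m, t * (2 * ∑ k, (X k * fe m k + Y k * ff m k)) / (1 + b) = G * Y m)
    (he2 : ∀ m, t * ((2 * ∑ k, (ee m k ^ 2 + ef m k ^ 2) +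
        2 * ∑ k, (X k * Pe m k + Y k * Qe m k)) / (1 + b) -
        (2 * ∑ k, (X k * ee m k + Y k * ef m k)) ^ 2 / (1 + b) ^ 2) +
        X m ^ 2 - G * ee m m ≤ 0)
    (hf2 : ∀ m, t * ((2 * ∑ k, (fe m k ^ 2 + ff m k ^ 2) +
        2 * ∑ k, (X k * Pf m k + Y k * Qf m k)) / (1 + b) -
        (2 * ∑ k, (X k * fe m k + Y k * ff m k)) ^ 2 / (1 + b) ^ 2) +
        Y m ^ 2 - G * ff m m ≤ 0)
    (htime : 0 ≤ Real.log (1 + b) + t * (2 * ∑ k, (X k * xt k + Y k * yt k)) / (1 + b) -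
        G * ut) :
    ∑ m, (lam m)⁻¹ * (G + (X m ^ 2 + Y m ^ 2) / 4) ≤
      Real.log (1 + b) + t * (∑ k, (Fx k ^ 2 + Fy k ^ 2) + 1 + 2 * |Fs|) +
        G * (2 + Fintype.card ι - ut) := by
  have hb0 : 0 ≤ b := hb ▸ Finset.sum_nonneg fun k _ => by positivity
  have hb1 : 0 < 1 + b := by linarith
  set q := t / (1 + b) with hq
  have hq0 : 0 < q := by positivity
  set R : ι → ℝ := fun m => ∑ k, (X k * (Pe m k + Pf m k) + Y k * (Qe m k + Qf m k)) with hR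
  have key (m) : (lam m)⁻¹ * (G + (X m ^ 2 + Y m ^ 2) / 4) + q * ((lam m)⁻¹ * R m / 2) ≤
      G + 2 * G / (1 + b) * (X m ^ 2 + Y m ^ 2) := by
    set κ := G / (2 * q) with hκ
    have hκq : 2 * q * κ = G := by rw [hκ]; field_simp
    have hP : ∑ k, (X k * ee m k + Y k * ef m k) = κ * X m := by
      have h : 2 * q * ∑ k, (X k * ee m k + Y k * ef m k) = G * X m := by
        rw [← he1 m, hq]; ring
      rw [← hκq] at h
      have : 2 * q ≠ 0 := by positivity
      apply mul_left_cancel₀ this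
      linarith
    have hQ : ∑ k, (X k * fe m k + Y k * ff m k) = κ * Y m := by
      have h : 2 * q * ∑ k, (X k * fe m k + Y k * ff m k) = G * Y m := by
        rw [← hf1 m, hq]; ring
      rw [← hκq] at h
      have : 2 * q ≠ 0 := by positivity
      apply mul_left_cancel₀ this
      linarith
    have hrow := hessian_row_estimate m X Y (ee m) (ef m) (ff m) (fe m) (2 * (lam m - 1)) κ
      (hef m) (fun k => by rw [hlevi m k]; split_ifs <;> ring) hP hQ
    rw [← hb] at hrow
    have h2 := add_nonpos (he2 m) (hf2 m)
    rw [hP, hQ] at h2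
    have hRm : R m = ∑ k, (X k * Pe m k + Y k * Qe m k) + ∑ k, (X k * Pf m k + Y k * Qf m k) := by
      rw [hR, ← Finset.sum_add_distrib]
      exact Finset.sum_congr rfl fun _ _ => by ring
    have hl : ee m m + ff m m = 4 * (lam m - 1) := by simpa using hlevi m m
    set S := ∑ k, (ee m k ^ 2 + ef m k ^ 2) + ∑ k, (fe m k ^ 2 + ff m k ^ 2) with hS
    have hS0 : 0 ≤ S := by
      refine add_nonneg ?_ ?_ <;> exact Finset.sum_nonneg fun k _ => by positivity
    set N := X m ^ 2 + Y m ^ 2 with hN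
    have h3 : q * (2 * S + 2 * R m) - q / (1 + b) * (4 * ((κ * X m) ^ 2 + (κ * Y m) ^ 2)) +
        N - G * (4 * (lam m - 1)) ≤ 0 := by
      refine le_trans (le_of_eq ?_) h2
      rw [← hl, hRm, hS, hN, hq]
      field_simp
      ring
    have h4 : q / (1 + b) * (4 * ((κ * X m) ^ 2 + (κ * Y m) ^ 2)) ≤
        2 * q * S + 8 * G * (lam m - 1) / (1 + b) * N := by
      have h5 : q / (1 + b) * (4 * ((κ * X m) ^ 2 + (κ * Y m) ^ 2)) ≤
          q / (1 + b) * (4 * (b * (S / 2) + 2 * (2 * (lam m - 1)) * κ * N)) := by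
        gcongr
      have h6 : q / (1 + b) * (4 * (b * (S / 2) + 2 * (2 * (lam m - 1)) * κ * N)) =
          2 * q * S * (b / (1 + b)) + 8 * (2 * q * κ) * (lam m - 1) / (1 + b) * N := by ring
      rw [h6, hκq] at h5
      have h7 : b / (1 + b) ≤ 1 := by rw [div_le_one hb1]; linarith
      have h8 : 2 * q * S * (b / (1 + b)) ≤ 2 * q * S * 1 := by gcongr
      linarith
    have h9 : q * (2 * R m) - 8 * G * (lam m - 1) / (1 + b) * N + N - G * (4 * (lam m - 1)) ≤ 0 := by
      linarith
    have hli : (lam m)⁻¹ * lam m = 1 := inv_mul_cancel₀ (hlam m).ne'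
    have hl0 : 0 < (lam m)⁻¹ := inv_pos.mpr (hlam m)
    have h10 := mul_nonpos_of_nonneg_of_nonpos hl0.le h9
    have h11 : 0 ≤ (lam m)⁻¹ * (2 * G / (1 + b) * N) := by positivity
    have h12 : (lam m)⁻¹ * (q * (2 * R m) - 8 * G * (lam m - 1) / (1 + b) * N + N -
        G * (4 * (lam m - 1))) = 4 * (q * ((lam m)⁻¹ * R m / 2)) -
        8 * G / (1 + b) * N * ((lam m)⁻¹ * lam m) + 4 * ((lam m)⁻¹ * (2 * G / (1 + b) * N)) +
        (lam m)⁻¹ * N - 4 * G * ((lam m)⁻¹ * lam m) + 4 * G * (lam m)⁻¹ := by ring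
    rw [h12, hli] at h10
    have h13 : 8 * G / (1 + b) * N * 1 = 4 * (2 * G / (1 + b) * N) := by ring
    rw [h13] at h10
    linarith
  have hsum := Finset.sum_le_sum fun m (_ : m ∈ Finset.univ) => key m
  rw [Finset.sum_add_distrib, Finset.sum_add_distrib, ← Finset.mul_sum, ← Finset.mul_sum, ← hb,
    Finset.sum_const, Finset.card_univ, nsmul_eq_mul] at hsum
  have hbb : 2 * G / (1 + b) * b ≤ 2 * G := by
    rw [div_mul_eq_mul_div, div_le_iff₀ hb1]; nlinarith
  have hbt : ∑ k, (X k * xt k + Y k * yt k) =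
      ∑ m, (lam m)⁻¹ * R m / 4 + ∑ k, (X k * Fx k + Y k * Fy k) + Fs * b := by
    have h1 : ∑ m, (lam m)⁻¹ * R m / 4 = ∑ k, (X k * ∑ m, (lam m)⁻¹ * ((Pe m k + Pf m k) / 4) +
        Y k * ∑ m, (lam m)⁻¹ * ((Qe m k + Qf m k) / 4)) := by
      simp only [hR, Finset.mul_sum, Finset.sum_div, ← Finset.sum_add_distrib]
      rw [Finset.sum_comm]
      exact Finset.sum_congr rfl fun _ _ => Finset.sum_congr rfl fun _ _ => by ring
    rw [h1, hb, Finset.mul_sum, ← Finset.sum_add_distrib, ← Finset.sum_add_distrib]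
    exact Finset.sum_congr rfl fun k _ => by rw [hxt, hyt]; ring
  have hF1 : 2 * ∑ k, (X k * Fx k + Y k * Fy k) ≤ ∑ k, (Fx k ^ 2 + Fy k ^ 2) + b := by
    rw [hb, ← Finset.sum_add_distrib, Finset.mul_sum]
    exact Finset.sum_le_sum fun k _ => by
      nlinarith [sq_nonneg (X k - Fx k), sq_nonneg (Y k - Fy k)]
  have hFxy : 0 ≤ ∑ k, (Fx k ^ 2 + Fy k ^ 2) := Finset.sum_nonneg fun k _ => by positivity
  have hF2 : q * (2 * ∑ k, (X k * Fx k + Y k * Fy k) + 2 * (Fs * b)) ≤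
      t * (∑ k, (Fx k ^ 2 + Fy k ^ 2) + 1 + 2 * |Fs|) := by
    have h1 : 2 * ∑ k, (X k * Fx k + Y k * Fy k) + 2 * (Fs * b) ≤
        (1 + b) * (∑ k, (Fx k ^ 2 + Fy k ^ 2) + 1 + 2 * |Fs|) := by
      have h2 : Fs * b ≤ |Fs| * b := mul_le_mul_of_nonneg_right (le_abs_self _) hb0
      nlinarith [abs_nonneg Fs, mul_nonneg hb0 hFxy]
    calc _ ≤ q * ((1 + b) * (∑ k, (Fx k ^ 2 + Fy k ^ 2) + 1 + 2 * |Fs|)) := by gcongr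
      _ = _ := by rw [hq]; field_simp
  have htime' : t * (2 * ∑ k, (X k * xt k + Y k * yt k)) / (1 + b) =
      q * ∑ m, (lam m)⁻¹ * R m / 2 +
        q * (2 * ∑ k, (X k * Fx k + Y k * Fy k) + 2 * (Fs * b)) := by
    have : ∑ m, (lam m)⁻¹ * R m / 2 = 2 * ∑ m, (lam m)⁻¹ * R m / 4 := by
      rw [Finset.mul_sum]; exact Finset.sum_congr rfl fun _ _ => by ring
    rw [hbt, this, hq]; ring
  rw [htime'] at htime
  linarith

/-- If the eigenvalues have bounded product and the `g`-gradient and the trace of the inverse are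
bounded by `L`, then the Euclidean gradient is bounded by a power of `L`. -/
theorem sum_sq_le_of_prod_le {n : ℕ} (lam N : Fin n → ℝ) (M L G : ℝ) (hlam : ∀ m, 0 < lam m)
    (hN : ∀ m, 0 ≤ N m) (hG : 1 ≤ G) (hprod : ∏ m, lam m ≤ M)
    (h : ∑ m, (lam m)⁻¹ * (G + N m / 4) ≤ L) :
    ∑ m, N m ≤ n * (4 * M * L ^ n) := by
  have hterm (m) : (lam m)⁻¹ * (G + N m / 4) ≤ L := by
    refine le_trans (Finset.single_le_sum (f := fun m => (lam m)⁻¹ * (G + N m / 4))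
      (fun i _ => ?_) (Finset.mem_univ m)) h
    have := hN i
    have := inv_pos.mpr (hlam i)
    positivity
  have hinv (m) : (lam m)⁻¹ ≤ L := by
    have h1 := inv_pos.mpr (hlam m)
    have h2 := hN m
    have h3 := hterm m
    nlinarith [mul_nonneg h1.le h2]
  have key (m) : N m ≤ 4 * M * L ^ n := by
    have h1 := inv_pos.mpr (hlam m)
    have hNm : N m ≤ 4 * lam m * L := by
      have h3 := hterm m
      have h4 : (lam m)⁻¹ * N m ≤ 4 * L := by nlinarith
      have h5 := mul_le_mul_of_nonneg_left h4 (hlam m).le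
      rw [← mul_assoc, mul_inv_cancel₀ (hlam m).ne'] at h5
      linarith
    have hl : lam m ≤ M * L ^ (n - 1) := by
      have h5 : lam m = (∏ i, lam i) * ∏ i ∈ Finset.univ.erase m, (lam i)⁻¹ := by
        rw [← Finset.mul_prod_erase _ _ (Finset.mem_univ m), mul_assoc, ← Finset.prod_mul_distrib,
          Finset.prod_congr rfl fun i _ => mul_inv_cancel₀ (hlam i).ne']
        simp
      have h6 : ∏ i ∈ Finset.univ.erase m, (lam i)⁻¹ ≤ L ^ (n - 1) := by
        refine (Finset.prod_le_prod (fun i _ => (inv_pos.mpr (hlam i)).le)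
          fun i _ => hinv i).trans (le_of_eq ?_)
        simp
      rw [h5]
      have h7 : 0 < ∏ i, lam i := Finset.prod_pos fun i _ => hlam i
      have h8 : 0 ≤ ∏ i ∈ Finset.univ.erase m, (lam i)⁻¹ :=
        Finset.prod_nonneg fun i _ => (inv_pos.mpr (hlam i)).le
      exact mul_le_mul hprod h6 h8 (h7.le.trans hprod)
    have hL : 0 ≤ L := h1.le.trans (hinv m)
    have hn : L ^ n = L ^ (n - 1) * L := by
      rw [← pow_succ, Nat.sub_add_cancel (Fin.pos m)]
    rw [hn]
    nlinarith [mul_le_mul_of_nonneg_right hl hL]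
  refine (Finset.sum_le_sum fun m _ => key m).trans (le_of_eq ?_)
  simp

theorem exists_bound_of_le_log_pow (n : ℕ) (K C₁ : ℝ) :
    ∃ C₂ : ℝ, 0 ≤ C₂ ∧ ∀ b : ℝ, 0 ≤ b → b ≤ K * (Real.log (1 + b) + C₁) ^ n → b ≤ C₂ := by
  have h1 : (fun x : ℝ => K * (Real.log x + C₁) ^ n) =o[atTop] (id : ℝ → ℝ) := by
    refine Asymptotics.IsLittleO.const_mul_left ?_ K
    have h2 : (fun x : ℝ => Real.log x + C₁) =O[atTop] Real.log := by
      refine (Asymptotics.isBigO_refl _ _).add ?_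
      exact (Asymptotics.isLittleO_const_left.mpr
        (Or.inr (tendsto_norm_atTop_atTop.comp Real.tendsto_log_atTop))).isBigO
    exact (h2.pow n).trans_isLittleO Real.isLittleO_pow_log_id_atTop
  have h3 := h1.bound (show (0 : ℝ) < 1 / 2 by norm_num)
  obtain ⟨A, hA⟩ := eventually_atTop.mp h3
  refine ⟨max A 1, le_trans zero_le_one (le_max_right _ _), fun b hb hle => ?_⟩
  by_contra! hlt
  have h4 := hA (1 + b) (by linarith [le_max_left A 1])
  have h5 := le_max_right A 1
  rw [id, Real.norm_eq_abs, Real.norm_eq_abs, abs_of_pos (by linarith : 0 < 1 + b)] at h4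
  linarith [le_abs_self (K * (Real.log (1 + b) + C₁) ^ n)]

/-- The derivative of `ψ` in the constant real direction `v`, as a function of the point. -/
def dirDeriv {n : ℕ} (v : Fin n → ℂ) (ψ : (Fin n → ℂ) → ℝ) : (Fin n → ℂ) → ℝ :=
  fun z => fderiv ℝ ψ z v

theorem contDiff_dirDeriv {n : ℕ} {ψ : (Fin n → ℂ) → ℝ} (hψ : ContDiff ℝ (⊤ : ℕ∞) ψ)
    (v : Fin n → ℂ) : ContDiff ℝ (⊤ : ℕ∞) (dirDeriv v ψ) :=
  (hψ.fderiv_right (m := (⊤ : ℕ∞)) (by simp)).clm_apply contDiff_const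

theorem hasDerivAt_line {n : ℕ} {ψ : (Fin n → ℂ) → ℝ} (hψ : ContDiff ℝ (⊤ : ℕ∞) ψ)
    (z v : Fin n → ℂ) (s : ℝ) :
    HasDerivAt (fun s : ℝ => ψ (z + s • v)) (dirDeriv v ψ (z + s • v)) s := by
  have h1 : HasFDerivAt ψ (fderiv ℝ ψ (z + s • v)) (z + s • v) :=
    (hψ.differentiable (by simp) _).hasFDerivAt
  have h2 : HasDerivAt (fun s : ℝ => z + s • v) v s := by
    simpa using ((hasDerivAt_id s).smul_const v).const_add z
  exact h1.comp_hasDerivAt s h2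

theorem fderiv_fderiv_apply {n : ℕ} {ψ : (Fin n → ℂ) → ℝ} (hψ : ContDiff ℝ (⊤ : ℕ∞) ψ)
    (z a c : Fin n → ℂ) : fderiv ℝ (fderiv ℝ ψ) z a c = dirDeriv a (dirDeriv c ψ) z := by
  have h : DifferentiableAt ℝ (fderiv ℝ ψ) z :=
    (hψ.fderiv_right (m := (⊤ : ℕ∞)) (by simp)).differentiable (by simp) z
  unfold dirDeriv
  rw [fderiv_clm_apply h (differentiableAt_const c)]
  simp

theorem dirDeriv_comm {n : ℕ} {ψ : (Fin n → ℂ) → ℝ} (hψ : ContDiff ℝ (⊤ : ℕ∞) ψ)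
    (a c : Fin n → ℂ) : dirDeriv a (dirDeriv c ψ) = dirDeriv c (dirDeriv a ψ) := by
  ext z
  rw [← fderiv_fderiv_apply hψ, ← fderiv_fderiv_apply hψ]
  refine (hψ.contDiffAt.isSymmSndFDerivAt ?_) a c
  rw [minSmoothness_of_isRCLikeNormedField]
  exact WithTop.coe_le_coe.mpr le_top

theorem complexHessian_eq_leviForm {n : ℕ} {ψ : (Fin n → ℂ) → ℝ} (hψ : ContDiff ℝ (⊤ : ℕ∞) ψ)
    (z : Fin n → ℂ) (p q : Fin n) :
    complexHessian ψ z p q =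
      leviForm (fderiv ℝ (fderiv ℝ ψ) z) (Pi.single p 1) (Pi.single q 1) := by
  have hI (p : Fin n) : Complex.I • (Pi.single p 1 : Fin n → ℂ) = Pi.single p Complex.I := by
    rw [← Pi.single_smul]; simp
  unfold leviForm
  rw [hI, hI]
  simp only [fderiv_fderiv_apply hψ]
  rfl

/-- The `m`-th vector of the frame of directions in which the unitary matrix `U` puts the
complex Hessian. -/
def frameVec {n : ℕ} (U : Matrix (Fin n) (Fin n) ℂ) (m : Fin n) : Fin n → ℂ :=
  fun p => star (U p m)

theorem conj_one_add_complexHessian {n : ℕ} {ψ : (Fin n → ℂ) → ℝ}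
    (hψ : ContDiff ℝ (⊤ : ℕ∞) ψ) {U : Matrix (Fin n) (Fin n) ℂ} (hU : U.conjTranspose * U = 1)
    (z : Fin n → ℂ) (m l : Fin n) :
    (U.conjTranspose * (1 + complexHessian ψ z) * U) m l =
      (1 : Matrix (Fin n) (Fin n) ℂ) m l +
        leviForm (fderiv ℝ (fderiv ℝ ψ) z) (frameVec U m) (frameVec U l) := by
  rw [mul_add, add_mul, mul_one, hU, Matrix.add_apply, leviForm_eq_sum, Matrix.mul_apply]
  congr 1
  simp only [Matrix.mul_apply, Finset.sum_mul, frameVec, star_star, Matrix.conjTranspose_apply]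
  rw [Finset.sum_comm]
  refine Finset.sum_congr rfl fun p _ => Finset.sum_congr rfl fun q _ => ?_
  rw [complexHessian_eq_leviForm hψ]
  ring

theorem hasDerivAt_det_of_eq_diagonal {ι : Type*} [Fintype ι] [DecidableEq ι]
    {M : ℝ → Matrix ι ι ℂ} {M' : Matrix ι ι ℂ} {d : ι → ℂ} {s : ℝ}
    (hM : ∀ i j, HasDerivAt (fun r => M r i j) (M' i j) s) (hd : M s = Matrix.diagonal d) :
    HasDerivAt (fun r => (M r).det) (∑ i, (∏ j ∈ Finset.univ.erase i, d j) * M' i i) s := by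
  have h1 : HasDerivAt (fun r => ∑ σ : Equiv.Perm ι, ((Equiv.Perm.sign σ : ℤ) : ℂ) *
      ∏ i, M r (σ i) i) (∑ σ : Equiv.Perm ι, ((Equiv.Perm.sign σ : ℤ) : ℂ) *
        ∑ i, (∏ j ∈ Finset.univ.erase i, M s (σ j) j) • M' (σ i) i) s :=
    HasDerivAt.fun_sum fun σ _ => (HasDerivAt.fun_finsetProd fun i _ => hM (σ i) i).const_mul _
  simp only [Matrix.det_apply']
  convert h1 using 1
  rw [Finset.sum_eq_single (1 : Equiv.Perm ι)]
  · simp [hd]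
  · intro σ _ hσ
    refine mul_eq_zero_of_right _ (Finset.sum_eq_zero fun i _ => ?_)
    obtain ⟨j, hji, hj⟩ : ∃ j, j ≠ i ∧ σ j ≠ j := by
      by_contra! hcon
      refine hσ (Equiv.ext fun k => ?_)
      by_cases hk : k = i
      · by_contra hne
        have hne' : σ k ≠ i := by rw [hk] at hne ⊢; exact hne
        exact hne (σ.injective (hcon _ hne'))
      · exact hcon k hk
    rw [Finset.prod_eq_zero (Finset.mem_erase.mpr ⟨hji, Finset.mem_univ j⟩), zero_smul]
    rw [hd, Matrix.diagonal_apply_ne _ hj]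
  · simp

theorem hasDerivAt_log_det {n : ℕ} {u : (Fin n → ℂ) → ℝ} (hu : ContDiff ℝ (⊤ : ℕ∞) u)
    {U : Matrix (Fin n) (Fin n) ℂ} {lam : Fin n → ℝ} {z : Fin n → ℂ}
    (hU : U.conjTranspose * U = 1) (hlam : ∀ m, 0 < lam m)
    (hdiag : U.conjTranspose * (1 + complexHessian u z) * U =
      Matrix.diagonal (fun m => (lam m : ℂ))) (v : Fin n → ℂ) :
    HasDerivAt (fun s : ℝ => Real.log ((1 : Matrix (Fin n) (Fin n) ℂ) +
        complexHessian u (z + s • v)).det.re)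
      (∑ m, (lam m)⁻¹ * ((dirDeriv (frameVec U m) (dirDeriv (frameVec U m) (dirDeriv v u)) z +
        dirDeriv (Complex.I • frameVec U m) (dirDeriv (Complex.I • frameVec U m)
          (dirDeriv v u)) z) / 4)) 0 := by
  set e := frameVec U with he
  set M : ℝ → Matrix (Fin n) (Fin n) ℂ :=
    fun s => U.conjTranspose * (1 + complexHessian u (z + s • v)) * U with hMdef
  have hdet (s : ℝ) : (1 + complexHessian u (z + s • v)).det = (M s).det := by
    have h1 : U.conjTranspose.det * U.det = 1 := by rw [← Matrix.det_mul, hU, Matrix.det_one]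
    simp only [hMdef, Matrix.det_mul]
    rw [mul_right_comm, h1, one_mul]
  have hMval (s : ℝ) (m l : Fin n) : M s m l = (1 : Matrix (Fin n) (Fin n) ℂ) m l +
      ((1 / 4 : ℂ) * ((dirDeriv (e m) (dirDeriv (e l) u) (z + s • v) +
        dirDeriv (Complex.I • e m) (dirDeriv (Complex.I • e l) u) (z + s • v) : ℝ) : ℂ) +
      (Complex.I / 4) * ((dirDeriv (e m) (dirDeriv (Complex.I • e l) u) (z + s • v) -
        dirDeriv (Complex.I • e m) (dirDeriv (e l) u) (z + s • v) : ℝ) : ℂ)) := by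
    simp only [hMdef]
    rw [conj_one_add_complexHessian hu hU]
    simp only [leviForm, fderiv_fderiv_apply hu, he]
  set D : (Fin n → ℂ) → (Fin n → ℂ) → ℝ := fun a c => dirDeriv v (dirDeriv a (dirDeriv c u)) z
    with hD
  have hDder (a c : Fin n → ℂ) :
      HasDerivAt (fun s : ℝ => dirDeriv a (dirDeriv c u) (z + s • v)) (D a c) 0 := by
    have := hasDerivAt_line (contDiff_dirDeriv (contDiff_dirDeriv hu c) a) z v 0
    simpa using this
  have hM (m l : Fin n) : HasDerivAt (fun s => M s m l)
      ((1 / 4 : ℂ) * ((D (e m) (e l) + D (Complex.I • e m) (Complex.I • e l) : ℝ) : ℂ) +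
      (Complex.I / 4) * ((D (e m) (Complex.I • e l) - D (Complex.I • e m) (e l) : ℝ) : ℂ)) 0 := by
    simp only [hMval]
    exact ((((hDder _ _).add (hDder _ _)).ofReal_comp.const_mul _).add
      (((hDder _ _).sub (hDder _ _)).ofReal_comp.const_mul _)).const_add _
  have hM0 : M 0 = Matrix.diagonal (fun m => (lam m : ℂ)) := by
    simp only [hMdef, zero_smul, add_zero, hdiag]
  have h1 := hasDerivAt_det_of_eq_diagonal (M := M) (M' := fun m l => _) hM hM0
  have h2 : HasDerivAt (fun s => (M s).det.re) (Complex.re _) 0 :=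
    (Complex.reCLM.hasFDerivAt).comp_hasDerivAt (0 : ℝ) h1
  have h0 : (M 0).det.re = ∏ m, lam m := by
    rw [hM0, Matrix.det_diagonal, ← Complex.ofReal_prod, Complex.ofReal_re]
  have hpos : 0 < ∏ m, lam m := Finset.prod_pos fun m _ => hlam m
  have h3 := h2.log (by simpa [h0] using hpos.ne')
  simp only [hdet]
  convert h3 using 1
  rw [h0, Complex.re_sum, Finset.sum_div]
  refine Finset.sum_congr rfl fun m _ => ?_
  rw [← Complex.ofReal_prod, Complex.re_ofReal_mul, ← Finset.mul_prod_erase _ _ (Finset.mem_univ m)]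
  have h4 : 0 < ∏ i ∈ Finset.univ.erase m, lam i := Finset.prod_pos fun m _ => hlam m
  have h5 := hlam m
  have h6 (a : Fin n → ℂ) : D a a = dirDeriv a (dirDeriv a (dirDeriv v u)) z := by
    simp only [hD]
    rw [dirDeriv_comm (contDiff_dirDeriv hu a), dirDeriv_comm hu v a]
  have h7 (x y : ℝ) : ((1 / 4 : ℂ) * (x : ℂ) + (Complex.I / 4) * (y : ℂ)).re = x / 4 := by
    have : ((1 / 4 : ℂ) * (x : ℂ) + (Complex.I / 4) * (y : ℂ)) =
        ((x / 4 : ℝ) : ℂ) + ((y / 4 : ℝ) : ℂ) * Complex.I := by push_cast; ring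
    rw [this]
    simp
  rw [h7, h6, h6]
  field_simp

theorem second_derivative_test {f f' : ℝ → ℝ} {c : ℝ} (hf : ∀ s, HasDerivAt f (f' s) s)
    (hf' : HasDerivAt f' c 0) (hmax : ∀ s, f s ≤ f 0) : f' 0 = 0 ∧ c ≤ 0 := by
  have hloc : IsLocalMax f 0 := Eventually.of_forall hmax
  have hd : deriv f = f' := funext fun s => (hf s).deriv
  have h0 : f' 0 = 0 := by rw [← hd]; exact hloc.deriv_eq_zero
  refine ⟨h0, ?_⟩
  by_contra! hc
  have hmin : IsLocalMin f 0 := isLocalMin_of_deriv_deriv_pos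
    (by rw [hd, hf'.deriv]; exact hc) (by rw [hd, h0]) (hf 0).continuousAt
  have hconst : f =ᶠ[𝓝 0] fun _ => f 0 := hmin.mono fun s hs => le_antisymm (hmax s) hs
  have h1 : deriv f =ᶠ[𝓝 0] fun _ => 0 := hconst.deriv.trans (by simp)
  have h2 := h1.deriv_eq
  rw [hd, hf'.deriv] at h2
  simp at h2
  linarith

theorem log_second_derivative_test {B B' U U' : ℝ → ℝ} {t A B'' U'' : ℝ} (hB0 : ∀ s, 0 ≤ B s)
    (hB : ∀ s, HasDerivAt B (B' s) s) (hB' : HasDerivAt B' B'' 0)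
    (hU : ∀ s, HasDerivAt U (U' s) s) (hU' : HasDerivAt U' U'' 0)
    (hmax : ∀ s, t * Real.log (1 + B s) - (A * U s - U s ^ 2 / 2) ≤
      t * Real.log (1 + B 0) - (A * U 0 - U 0 ^ 2 / 2)) :
    t * B' 0 / (1 + B 0) = (A - U 0) * U' 0 ∧
      t * (B'' / (1 + B 0) - B' 0 ^ 2 / (1 + B 0) ^ 2) + U' 0 ^ 2 - (A - U 0) * U'' ≤ 0 := by
  have hne (s) : 1 + B s ≠ 0 := by have := hB0 s; positivity
  have h1 (s : ℝ) : HasDerivAt (fun s => t * Real.log (1 + B s) - (A * U s - U s ^ 2 / 2))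
      (t * (B' s / (1 + B s)) - (A - U s) * U' s) s := by
    refine (((((hB s).const_add 1).log (hne s)).const_mul t).sub
      (((hU s).const_mul A).sub (((hU s).pow 2).div_const 2))).congr_deriv ?_
    push_cast
    ring
  have h2 : HasDerivAt (fun s => t * (B' s / (1 + B s)) - (A - U s) * U' s)
      (t * (B'' / (1 + B 0) - B' 0 ^ 2 / (1 + B 0) ^ 2) + U' 0 ^ 2 - (A - U 0) * U'') 0 := by
    refine (((hB'.div ((hB 0).const_add 1) (hne 0)).const_mul t).sub
      (((hU 0).const_sub A).mul hU')).congr_deriv ?_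
    have := hne 0
    field_simp
    ring
  obtain ⟨h3, h4⟩ := second_derivative_test h1 h2 hmax
  exact ⟨by rw [mul_div_assoc]; linarith, h4⟩

theorem direction_test {n : ℕ} {ι : Type*} [Fintype ι] {u : (Fin n → ℂ) → ℝ}
    (hu : ContDiff ℝ (⊤ : ℕ∞) u) (e f : ι → Fin n → ℂ) (v z : Fin n → ℂ) {t A b : ℝ}
    (hb : b = ∑ k, (dirDeriv (e k) u z ^ 2 + dirDeriv (f k) u z ^ 2))
    (hmax : ∀ w, t * Real.log (1 + ∑ k, (dirDeriv (e k) u w ^ 2 + dirDeriv (f k) u w ^ 2)) -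
      (A * u w - u w ^ 2 / 2) ≤ t * Real.log (1 + b) - (A * u z - u z ^ 2 / 2)) :
    t * (2 * ∑ k, (dirDeriv (e k) u z * dirDeriv v (dirDeriv (e k) u) z +
        dirDeriv (f k) u z * dirDeriv v (dirDeriv (f k) u) z)) / (1 + b) =
      (A - u z) * dirDeriv v u z ∧
    t * ((2 * ∑ k, (dirDeriv v (dirDeriv (e k) u) z ^ 2 + dirDeriv v (dirDeriv (f k) u) z ^ 2) +
        2 * ∑ k, (dirDeriv (e k) u z * dirDeriv v (dirDeriv v (dirDeriv (e k) u)) z +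
          dirDeriv (f k) u z * dirDeriv v (dirDeriv v (dirDeriv (f k) u)) z)) / (1 + b) -
      (2 * ∑ k, (dirDeriv (e k) u z * dirDeriv v (dirDeriv (e k) u) z +
        dirDeriv (f k) u z * dirDeriv v (dirDeriv (f k) u) z)) ^ 2 / (1 + b) ^ 2) +
      dirDeriv v u z ^ 2 - (A - u z) * dirDeriv v (dirDeriv v u) z ≤ 0 := by
  have hd (a : Fin n → ℂ) := contDiff_dirDeriv hu a
  have hline (a : Fin n → ℂ) (s : ℝ) := hasDerivAt_line (hd a) z v s
  have hline' (a : Fin n → ℂ) :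
      HasDerivAt (fun s : ℝ => dirDeriv v (dirDeriv a u) (z + s • v))
        (dirDeriv v (dirDeriv v (dirDeriv a u)) z) 0 := by
    simpa using hasDerivAt_line (contDiff_dirDeriv (hd a) v) z v 0
  have hU' : HasDerivAt (fun s : ℝ => dirDeriv v u (z + s • v)) (dirDeriv v (dirDeriv v u) z) 0 := by
    simpa using hline v 0
  have hB (s : ℝ) : HasDerivAt
      (fun s : ℝ => ∑ k, (dirDeriv (e k) u (z + s • v) ^ 2 + dirDeriv (f k) u (z + s • v) ^ 2))
      (2 * ∑ k, (dirDeriv (e k) u (z + s • v) * dirDeriv v (dirDeriv (e k) u) (z + s • v) +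
        dirDeriv (f k) u (z + s • v) * dirDeriv v (dirDeriv (f k) u) (z + s • v))) s := by
    refine (HasDerivAt.fun_sum fun k _ =>
      ((hline (e k) s).pow 2).add ((hline (f k) s).pow 2)).congr_deriv ?_
    rw [Finset.mul_sum]
    exact Finset.sum_congr rfl fun k _ => by push_cast; ring
  have hB' : HasDerivAt
      (fun s : ℝ => 2 * ∑ k, (dirDeriv (e k) u (z + s • v) *
          dirDeriv v (dirDeriv (e k) u) (z + s • v) +
        dirDeriv (f k) u (z + s • v) * dirDeriv v (dirDeriv (f k) u) (z + s • v)))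
      (2 * ∑ k, (dirDeriv v (dirDeriv (e k) u) z ^ 2 + dirDeriv v (dirDeriv (f k) u) z ^ 2) +
        2 * ∑ k, (dirDeriv (e k) u z * dirDeriv v (dirDeriv v (dirDeriv (e k) u)) z +
          dirDeriv (f k) u z * dirDeriv v (dirDeriv v (dirDeriv (f k) u)) z)) 0 := by
    refine ((HasDerivAt.fun_sum fun k _ => ((hline (e k) 0).mul (hline' (e k))).add
      ((hline (f k) 0).mul (hline' (f k)))).const_mul 2).congr_deriv ?_
    simp only [zero_smul, add_zero]
    rw [← mul_add, ← Finset.sum_add_distrib]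
    exact congrArg _ (Finset.sum_congr rfl fun k _ => by ring)
  have h := log_second_derivative_test (t := t) (A := A)
    (fun s => Finset.sum_nonneg fun k _ => by positivity) hB hB'
    (fun s => hasDerivAt_line hu z v s) hU' (fun s => by
      have := hmax (z + s • v)
      simpa [← hb] using this)
  simpa only [zero_smul, add_zero, ← hb] using h

theorem nonneg_deriv_of_max_left {f : ℝ → ℝ} {d t : ℝ} (ht : 0 < t) (hf : HasDerivAt f d t)
    (hmax : ∀ s ∈ Icc 0 t, f s ≤ f t) : 0 ≤ d := by
  have h1 := (hasDerivWithinAt_iff_tendsto_slope' (self_notMem_Iio (a := t))).mp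
    (hf.hasDerivWithinAt (s := Iio t))
  refine ge_of_tendsto h1 ?_
  filter_upwards [Ioo_mem_nhdsLT ht] with s hs
  rw [slope_def_field]
  exact div_nonneg_of_nonpos (sub_nonpos.mpr (hmax s ⟨hs.1.le, hs.2.le⟩)) (by linarith [hs.2])

theorem contDiff_slice {n : ℕ} {T : ℝ} {φ : ℝ → (Fin n → ℂ) → ℝ}
    (hφ : ContDiffOn ℝ (⊤ : ℕ∞) (fun p : ℝ × (Fin n → ℂ) => φ p.1 p.2) (Icc 0 T ×ˢ univ))
    {t : ℝ} (ht : t ∈ Icc 0 T) : ContDiff ℝ (⊤ : ℕ∞) (φ t) := by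
  rw [← contDiffOn_univ]
  exact hφ.comp (s := univ) (f := fun z => (t, z)) (contDiff_prodMk_right t).contDiffOn
    fun z _ => ⟨ht, mem_univ z⟩

/-- Time derivatives commute with space derivatives for a solution of an evolution equation
`∂φ/∂t = R`. -/
theorem hasDerivAt_time_dirDeriv {n : ℕ} {T : ℝ} {φ R : ℝ → (Fin n → ℂ) → ℝ}
    (hφ : ContDiffOn ℝ (⊤ : ℕ∞) (fun p : ℝ × (Fin n → ℂ) => φ p.1 p.2) (Icc 0 T ×ˢ univ))
    (hR : ∀ t ∈ Ioo 0 T, ∀ z, HasDerivAt (fun s => φ s z) (R t z) t)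
    {t : ℝ} (ht : t ∈ Ioo 0 T) (z v : Fin n → ℂ) {d : ℝ}
    (hd : HasDerivAt (fun s : ℝ => R t (z + s • v)) d 0) :
    HasDerivAt (fun s => dirDeriv v (φ s) z) d t := by
  set Φ : ℝ × (Fin n → ℂ) → ℝ := fun p => φ p.1 p.2 with hΦ
  have hsm (s : ℝ) (hs : s ∈ Ioo 0 T) (w : Fin n → ℂ) : ContDiffAt ℝ (⊤ : ℕ∞) Φ (s, w) :=
    hφ.contDiffAt (prod_mem_nhds (Icc_mem_nhds hs.1 hs.2) univ_mem)
  have hdiff (s : ℝ) (hs : s ∈ Ioo 0 T) (w : Fin n → ℂ) :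
      HasFDerivAt Φ (fderiv ℝ Φ (s, w)) (s, w) :=
    ((hsm s hs w).differentiableAt (by simp)).hasFDerivAt
  have hspace (s : ℝ) (hs : s ∈ Ioo 0 T) : dirDeriv v (φ s) z = fderiv ℝ Φ (s, z) (0, v) := by
    have h : HasFDerivAt (φ s) _ z := (hdiff s hs z).comp z (hasFDerivAt_prodMk_right s z)
    simp [dirDeriv, h.fderiv]
  have htime (w : Fin n → ℂ) : R t w = fderiv ℝ Φ (t, w) (1, 0) := by
    have h1 : HasDerivAt (fun s : ℝ => (s, w)) ((1 : ℝ), (0 : Fin n → ℂ)) t :=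
      (hasDerivAt_id t).prodMk (hasDerivAt_const t w)
    have h2 := (hdiff t ht w).comp_hasDerivAt t h1
    exact (hR t ht w).unique h2
  have h2 : HasFDerivAt (fderiv ℝ Φ) (fderiv ℝ (fderiv ℝ Φ) (t, z)) (t, z) :=
    (((hsm t ht z).fderiv_right (m := (⊤ : ℕ∞)) (by simp)).differentiableAt
      (by simp)).hasFDerivAt
  have hsymm := ((hsm t ht z).isSymmSndFDerivAt (by
    rw [minSmoothness_of_isRCLikeNormedField]
    exact WithTop.coe_le_coe.mpr le_top)) (1, 0) (0, v)
  have hA : HasDerivAt (fun s : ℝ => fderiv ℝ Φ (s, z) (0, v))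
      (fderiv ℝ (fderiv ℝ Φ) (t, z) (1, 0) (0, v)) t := by
    have h1 : HasDerivAt (fun s : ℝ => (s, z)) ((1 : ℝ), (0 : Fin n → ℂ)) t :=
      (hasDerivAt_id t).prodMk (hasDerivAt_const t z)
    have h3 := h2.comp_hasDerivAt t h1
    simpa using h3.clm_apply (hasDerivAt_const t ((0 : ℝ), v))
  have hB : HasDerivAt (fun s : ℝ => fderiv ℝ Φ (t, z + s • v) (1, 0))
      (fderiv ℝ (fderiv ℝ Φ) (t, z) (0, v) (1, 0)) 0 := by
    have h0 : HasDerivAt (fun s : ℝ => z + s • v) v 0 := by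
      simpa using ((hasDerivAt_id (0 : ℝ)).smul_const v).const_add z
    have h1 : HasDerivAt (fun s : ℝ => (t, z + s • v)) ((0 : ℝ), v) 0 :=
      (hasDerivAt_const _ t).prodMk h0
    have h2' : HasFDerivAt (fderiv ℝ Φ) (fderiv ℝ (fderiv ℝ Φ) (t, z)) (t, z + (0 : ℝ) • v) := by
      simpa using h2
    have h3 := h2'.comp_hasDerivAt (0 : ℝ) h1
    simpa using h3.clm_apply (hasDerivAt_const (0 : ℝ) ((1 : ℝ), (0 : Fin n → ℂ)))
  have hd' : d = fderiv ℝ (fderiv ℝ Φ) (t, z) (1, 0) (0, v) := by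
    rw [hsymm]
    refine hd.unique ?_
    simpa only [htime] using hB
  rw [hd']
  refine hA.congr_of_eventuallyEq ?_
  filter_upwards [Ioo_mem_nhds ht.1 ht.2] with s hs using hspace s hs

theorem gradSq_eq_frame {n : ℕ} {U : Matrix (Fin n) (Fin n) ℂ}
    (hU : U * U.conjTranspose = 1) (ψ : (Fin n → ℂ) → ℝ) (z : Fin n → ℂ) :
    gradSq ψ z = ∑ k, (dirDeriv (frameVec U k) ψ z ^ 2 +
      dirDeriv (Complex.I • frameVec U k) ψ z ^ 2) :=
  (sum_sq_unitary_frame hU (fderiv ℝ ψ z)).symm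

theorem leviForm_re {n : ℕ} (B : (Fin n → ℂ) →L[ℝ] (Fin n → ℂ) →L[ℝ] ℝ) (a c : Fin n → ℂ) :
    (leviForm B a c).re = (B a c + B (Complex.I • a) (Complex.I • c)) / 4 := by
  have : leviForm B a c = (((B a c + B (Complex.I • a) (Complex.I • c)) / 4 : ℝ) : ℂ) +
      (((B a (Complex.I • c) - B (Complex.I • a) c) / 4 : ℝ) : ℂ) * Complex.I := by
    unfold leviForm; push_cast; ring
  rw [this]; simp

theorem leviForm_im {n : ℕ} (B : (Fin n → ℂ) →L[ℝ] (Fin n → ℂ) →L[ℝ] ℝ) (a c : Fin n → ℂ) :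
    (leviForm B a c).im = (B a (Complex.I • c) - B (Complex.I • a) c) / 4 := by
  have : leviForm B a c = (((B a c + B (Complex.I • a) (Complex.I • c)) / 4 : ℝ) : ℂ) +
      (((B a (Complex.I • c) - B (Complex.I • a) c) / 4 : ℝ) : ℂ) * Complex.I := by
    unfold leviForm; push_cast; ring
  rw [this]; simp

/-- The derivative along a line of the reaction term `F(u(z), z)`. -/
theorem hasDerivAt_reaction {n : ℕ} {F : ℝ → (Fin n → ℂ) → ℝ} {u : (Fin n → ℂ) → ℝ}
    (hF : ContDiff ℝ (⊤ : ℕ∞) (fun p : ℝ × (Fin n → ℂ) => F p.1 p.2))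
    (hu : ContDiff ℝ (⊤ : ℕ∞) u) (z v : Fin n → ℂ) :
    HasDerivAt (fun s : ℝ => F (u (z + s • v)) (z + s • v))
      (fderiv ℝ (fun p : ℝ × (Fin n → ℂ) => F p.1 p.2) (u z, z) (1, 0) * dirDeriv v u z +
        dirDeriv v (F (u z)) z) 0 := by
  set Φ : ℝ × (Fin n → ℂ) → ℝ := fun p => F p.1 p.2 with hΦ
  have hdiff (p : ℝ × (Fin n → ℂ)) : HasFDerivAt Φ (fderiv ℝ Φ p) p :=
    (hF.differentiable (by simp) p).hasFDerivAt
  have hv : dirDeriv v (F (u z)) z = fderiv ℝ Φ (u z, z) (0, v) := by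
    have h : HasFDerivAt (F (u z)) _ z :=
      (hdiff (u z, z)).comp z (hasFDerivAt_prodMk_right (u z) z)
    simp [dirDeriv, h.fderiv]
  have h0 : HasDerivAt (fun s : ℝ => z + s • v) v 0 := by
    simpa using ((hasDerivAt_id (0 : ℝ)).smul_const v).const_add z
  have h1 := hasDerivAt_line hu z v 0
  have h2 := (hdiff (u (z + (0 : ℝ) • v), z + (0 : ℝ) • v)).comp_hasDerivAt (0 : ℝ) (h1.prodMk h0)
  refine h2.congr_deriv ?_
  have h3 : (dirDeriv v u z, v) = dirDeriv v u z • ((1 : ℝ), (0 : Fin n → ℂ)) + (0, v) := by simp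
  rw [zero_smul, add_zero, h3, map_add, map_smul, smul_eq_mul, hv, mul_comm]

theorem complexHessian_frame_diagonal {n : ℕ} {u : (Fin n → ℂ) → ℝ}
    (hu : ContDiff ℝ (⊤ : ℕ∞) u) {U : Matrix (Fin n) (Fin n) ℂ} {lam : Fin n → ℝ}
    {z : Fin n → ℂ} (hU : U.conjTranspose * U = 1)
    (hdiag : U.conjTranspose * (1 + complexHessian u z) * U =
      Matrix.diagonal (fun m => (lam m : ℂ))) (m k : Fin n) :
    (dirDeriv (Complex.I • frameVec U m) (dirDeriv (frameVec U k) u) z =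
      dirDeriv (frameVec U m) (dirDeriv (Complex.I • frameVec U k) u) z) ∧
    dirDeriv (frameVec U m) (dirDeriv (frameVec U k) u) z +
      dirDeriv (Complex.I • frameVec U m) (dirDeriv (Complex.I • frameVec U k) u) z =
        if k = m then 4 * (lam m - 1) else 0 := by
  have h := conj_one_add_complexHessian hu hU z m k
  rw [hdiag] at h
  have hre := congrArg Complex.re h
  have him := congrArg Complex.im h
  rw [Complex.add_re, leviForm_re] at hre
  rw [Complex.add_im, leviForm_im] at him
  simp only [fderiv_fderiv_apply hu] at hre him
  rcases eq_or_ne k m with rfl | hkm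
  · simp at hre him ⊢
    constructor <;> linarith
  · rw [Matrix.diagonal_apply_ne _ hkm.symm, Matrix.one_apply_ne hkm.symm] at hre him
    simp at hre him
    rw [if_neg hkm]
    constructor <;> linarith

/-- Bound for the gradient at a maximum of `t log (1 + |∇φ|²) - γ(φ)`, where
`γ(s) = (2 C₀ + 1) s - s² / 2`. -/
theorem gradSq_le_at_max {n : ℕ} {F : ℝ → (Fin n → ℂ) → ℝ} {φ : ℝ → (Fin n → ℂ) → ℝ}
    {T C₀ M₁ M₂ M₃ : ℝ} (hF : ContDiff ℝ (⊤ : ℕ∞) (fun p : ℝ × (Fin n → ℂ) => F p.1 p.2))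
    (hM₁ : ∀ s ∈ Icc (-C₀) C₀, ∀ z, gradSq (F s) z ≤ M₁)
    (hM₂ : ∀ s ∈ Icc (-C₀) C₀, ∀ z : Fin n → ℂ,
      |fderiv ℝ (fun p : ℝ × (Fin n → ℂ) => F p.1 p.2) (s, z) (1, 0)| ≤ M₂)
    (hM₃ : ∀ s ∈ Icc (-C₀) C₀, ∀ z, |F s z| ≤ M₃)
    (hsol : IsMAFlowSolution F 1 T φ)
    (hφ : ∀ t ∈ Icc (0 : ℝ) T, ∀ z, |φ t z| ≤ C₀)
    (hφt : ∀ t ∈ Icc (0 : ℝ) T, ∀ z, |Real.log (((1 : Matrix (Fin n) (Fin n) ℂ)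
      + complexHessian (φ t) z).det.re) + F (φ t z) z| ≤ C₀)
    {t : ℝ} (ht : t ∈ Ioo 0 T) (z : Fin n → ℂ)
    (hspace : ∀ w, t * Real.log (1 + gradSq (φ t) w) -
      ((2 * C₀ + 1) * φ t w - φ t w ^ 2 / 2) ≤
      t * Real.log (1 + gradSq (φ t) z) - ((2 * C₀ + 1) * φ t z - φ t z ^ 2 / 2))
    (htime : ∀ s ∈ Icc 0 t, s * Real.log (1 + gradSq (φ s) z) -
      ((2 * C₀ + 1) * φ s z - φ s z ^ 2 / 2) ≤
      t * Real.log (1 + gradSq (φ t) z) - ((2 * C₀ + 1) * φ t z - φ t z ^ 2 / 2)) :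
    gradSq (φ t) z ≤ n * (4 * Real.exp (C₀ + M₃)) * (Real.log (1 + gradSq (φ t) z) +
      (T * (M₁ + 1 + 2 * M₂) + (3 * C₀ + 1) * (2 + n + C₀))) ^ n := by
  obtain ⟨hsmooth, -, hpos, heq⟩ := hsol
  have htI : t ∈ Icc 0 T := ⟨ht.1.le, ht.2.le⟩
  set u := φ t with hu_def
  have hu : ContDiff ℝ (⊤ : ℕ∞) u := contDiff_slice hsmooth htI
  obtain ⟨U, lam, hU, hU', hlam, hdiag⟩ := exists_unitary_diagonalization (hpos t htI z)
  set e := frameVec U with he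
  set f : Fin n → Fin n → ℂ := fun m => Complex.I • frameVec U m with hf
  set R : ℝ → (Fin n → ℂ) → ℝ := fun s w => Real.log (((1 : Matrix (Fin n) (Fin n) ℂ)
    + complexHessian (φ s) w).det.re) + F (φ s w) w with hRdef
  have hR : ∀ s ∈ Ioo 0 T, ∀ w, HasDerivAt (fun r => φ r w) (R s w) s := fun s hs w => by
    have := (heq s ⟨hs.1.le, hs.2.le⟩ w).hasDerivAt (Icc_mem_nhds hs.1 hs.2)
    simpa [hRdef] using this
  have huC := abs_le.mp (hφ t htI z)
  have hutC := abs_le.mp (hφt t htI z)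
  have hM1 := hM₁ (u z) huC z
  have hM2 := hM₂ (u z) huC z
  have hM3 := hM₃ (u z) huC z
  have hC₀ : 0 ≤ C₀ := by linarith [huC.1, huC.2]
  set b := gradSq u z with hb
  have hgrad (ψ : (Fin n → ℂ) → ℝ) (w : Fin n → ℂ) :
      gradSq ψ w = ∑ k, (dirDeriv (e k) ψ w ^ 2 + dirDeriv (f k) ψ w ^ 2) :=
    gradSq_eq_frame hU' ψ w
  have hbsum : b = ∑ k, (dirDeriv (e k) u z ^ 2 + dirDeriv (f k) u z ^ 2) := hgrad u z
  have hdir (v : Fin n → ℂ) := direction_test hu e f v z hbsum (t := t) (A := 2 * C₀ + 1)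
    (fun w => by rw [← hgrad]; exact hspace w)
  set Fs := fderiv ℝ (fun p : ℝ × (Fin n → ℂ) => F p.1 p.2) (u z, z) (1, 0) with hFs
  have hmixed (v : Fin n → ℂ) := hasDerivAt_time_dirDeriv hsmooth hR ht z v
    ((hasDerivAt_log_det hu hU hlam hdiag v).add (hasDerivAt_reaction hF hu z v))
  have hb0 : 0 ≤ b := by
    rw [hbsum]; exact Finset.sum_nonneg fun k _ => by positivity
  set ut := R t z with hut
  have htime' := nonneg_deriv_of_max_left ht.1
    (((hasDerivAt_id t).mul (((HasDerivAt.fun_sum fun k (_ : k ∈ Finset.univ) =>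
      ((hmixed (e k)).pow 2).add ((hmixed (f k)).pow 2)).const_add 1).log (by
        simp only [Pi.add_apply, Pi.pow_apply, ← hu_def, ← hbsum]; positivity))).sub
      (((hR t ht z).const_mul (2 * C₀ + 1)).sub (((hR t ht z).pow 2).div_const 2)))
    (fun s hs => by
      have := htime s hs
      rw [hgrad, hbsum] at this
      exact this)
  simp only [id, one_mul, Pi.add_apply, Pi.pow_apply, ← hu_def, ← hbsum] at htime'
  have hG1 : 1 ≤ 2 * C₀ + 1 - u z := by linarith [huC.2]
  have hG2 : 2 * C₀ + 1 - u z ≤ 3 * C₀ + 1 := by linarith [huC.1]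
  have hmain := blocki_pointwise lam (fun k => dirDeriv (e k) u z) (fun k => dirDeriv (f k) u z)
    (fun k => dirDeriv (e k) (F (u z)) z) (fun k => dirDeriv (f k) (F (u z)) z) _ _
    (fun m k => dirDeriv (e m) (dirDeriv (e k) u) z)
    (fun m k => dirDeriv (e m) (dirDeriv (f k) u) z)
    (fun m k => dirDeriv (f m) (dirDeriv (e k) u) z)
    (fun m k => dirDeriv (f m) (dirDeriv (f k) u) z)
    (fun m k => dirDeriv (e m) (dirDeriv (e m) (dirDeriv (e k) u)) z)
    (fun m k => dirDeriv (e m) (dirDeriv (e m) (dirDeriv (f k) u)) z)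
    (fun m k => dirDeriv (f m) (dirDeriv (f m) (dirDeriv (e k) u)) z)
    (fun m k => dirDeriv (f m) (dirDeriv (f m) (dirDeriv (f k) u)) z)
    t (2 * C₀ + 1 - u z) ut Fs b hlam ht.1 (by linarith) hbsum
    (fun m k => (complexHessian_frame_diagonal hu hU hdiag m k).1)
    (fun m k => (complexHessian_frame_diagonal hu hU hdiag m k).2)
    (fun k => rfl) (fun k => rfl)
    (fun m => (hdir (e m)).1) (fun m => (hdir (f m)).1)
    (fun m => (hdir (e m)).2) (fun m => (hdir (f m)).2) (by
      refine htime'.trans (le_of_eq ?_)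
      have h1 (a b c d : ℝ) : (2 : ℕ) * a ^ (2 - 1) * b + (2 : ℕ) * c ^ (2 - 1) * d =
        2 * (a * b + c * d) := by push_cast; ring
      simp only [h1, ← Finset.mul_sum]
      push_cast
      ring)
  rw [← hgrad, Fintype.card_fin] at hmain
  have hL : Real.log (1 + b) + t * (gradSq (F (u z)) z + 1 + 2 * |Fs|) +
      (2 * C₀ + 1 - u z) * (2 + n - ut) ≤
      Real.log (1 + b) + (T * (M₁ + 1 + 2 * M₂) + (3 * C₀ + 1) * (2 + n + C₀)) := by
    have hg0 : 0 ≤ gradSq (F (u z)) z := by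
      rw [hgrad]; exact Finset.sum_nonneg fun k _ => by positivity
    have h1 : t * (gradSq (F (u z)) z + 1 + 2 * |Fs|) ≤ T * (M₁ + 1 + 2 * M₂) := by
      refine mul_le_mul ht.2.le (by linarith) (by positivity) (ht.1.trans ht.2).le
    have h2 : (2 * C₀ + 1 - u z) * (2 + n - ut) ≤ (3 * C₀ + 1) * (2 + n + C₀) := by
      have hn : (0 : ℝ) ≤ n := Nat.cast_nonneg n
      have h3 : (2 * C₀ + 1 - u z) * (2 + n - ut) ≤ (2 * C₀ + 1 - u z) * (2 + n + C₀) :=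
        mul_le_mul_of_nonneg_left (by linarith [hutC.1]) (by linarith)
      exact h3.trans (mul_le_mul_of_nonneg_right hG2 (by positivity))
    linarith
  have hprod : ∏ m, lam m ≤ Real.exp (C₀ + M₃) := by
    have hp : 0 < ∏ m, lam m := Finset.prod_pos fun m _ => hlam m
    have hdet : ((1 : Matrix (Fin n) (Fin n) ℂ) + complexHessian u z).det.re = ∏ m, lam m := by
      have h1 := congrArg Matrix.det hdiag
      have h2 : U.conjTranspose.det * U.det = 1 := by rw [← Matrix.det_mul, hU, Matrix.det_one]
      rw [Matrix.det_mul, Matrix.det_mul, mul_right_comm, h2, one_mul, Matrix.det_diagonal,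
        ← Complex.ofReal_prod] at h1
      rw [h1, Complex.ofReal_re]
    rw [hdet] at hutC
    rw [← Real.log_le_iff_le_exp hp]
    linarith [hutC.2, (abs_le.mp hM3).1]
  have hfin := sum_sq_le_of_prod_le lam _ _ _ _ hlam (fun m => by positivity) hG1 hprod
    (hmain.trans hL)
  rw [← hbsum] at hfin
  linarith

/-- The closed fundamental domain of the lattice `ℤⁿ + iℤⁿ`. -/
def unitCube (n : ℕ) : Set (Fin n → ℂ) :=
  Set.pi univ fun _ => Icc 0 1 ×ℂ Icc 0 1

theorem isCompact_unitCube (n : ℕ) : IsCompact (unitCube n) :=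
  isCompact_univ_pi fun _ => isCompact_Icc.reProdIm isCompact_Icc

theorem zero_mem_unitCube (n : ℕ) : (0 : Fin n → ℂ) ∈ unitCube n := by
  simp [unitCube, Complex.mem_reProdIm]

theorem exists_mem_unitCube {n : ℕ} (z : Fin n → ℂ) :
    ∃ w ∈ unitCube n, ∀ ψ : (Fin n → ℂ) → ℝ, SpacePeriodic ψ → ψ z = ψ w := by
  refine ⟨fun p => z p + ((-⌊(z p).re⌋ : ℤ) : ℂ) + ((-⌊(z p).im⌋ : ℤ) : ℂ) * Complex.I,
    ?_, fun ψ hψ => (hψ z (fun p => -⌊(z p).re⌋) (fun p => -⌊(z p).im⌋)).symm⟩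
  intro p _
  have h1 := Int.floor_le (z p).re
  have h2 := (Int.lt_floor_add_one (z p).re).le
  have h3 := Int.floor_le (z p).im
  have h4 := (Int.lt_floor_add_one (z p).im).le
  simp only [Complex.mem_reProdIm, mem_Icc]
  simp
  refine ⟨⟨?_, ?_⟩, ?_, ?_⟩ <;> linarith

/-- A continuous function that is periodic in the space variable attains its maximum. -/
theorem exists_max_of_spacePeriodic {n : ℕ} {a b : ℝ} (hab : a ≤ b)
    {G : ℝ → (Fin n → ℂ) → ℝ}
    (hG : ContinuousOn (fun p : ℝ × (Fin n → ℂ) => G p.1 p.2) (Icc a b ×ˢ univ))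
    (hper : ∀ s ∈ Icc a b, SpacePeriodic (G s)) :
    ∃ t ∈ Icc a b, ∃ z, ∀ s ∈ Icc a b, ∀ w, G s w ≤ G t z := by
  obtain ⟨p, hp, hmax⟩ := (isCompact_Icc.prod (isCompact_unitCube n)).exists_isMaxOn
    ⟨(a, 0), left_mem_Icc.mpr hab, zero_mem_unitCube n⟩
    (hG.mono (prod_mono subset_rfl (subset_univ _)))
  refine ⟨p.1, hp.1, p.2, fun s hs w => ?_⟩
  obtain ⟨w', hw', hw⟩ := exists_mem_unitCube w
  rw [hw _ (hper s hs)]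
  exact hmax (show (s, w') ∈ _ from ⟨hs, hw'⟩)

theorem SpacePeriodic.gradSq {n : ℕ} {ψ : (Fin n → ℂ) → ℝ} (hψ : SpacePeriodic ψ) :
    SpacePeriodic (gradSq ψ) := by
  intro z a b
  have h : (fun w => ψ (w + fun p => (a p : ℂ) + (b p : ℂ) * Complex.I)) = ψ := by
    funext w
    simpa [Pi.add_def, add_assoc] using hψ w a b
  have hz : (fun p => z p + (a p : ℂ) + (b p : ℂ) * Complex.I) =
      z + fun p => (a p : ℂ) + (b p : ℂ) * Complex.I := by
    funext p; simp [add_assoc]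
  have hd := fderiv_comp_add_right (𝕜 := ℝ) (f := ψ) (x := z)
    (fun p => (a p : ℂ) + (b p : ℂ) * Complex.I)
  rw [h] at hd
  simp only [_root_.gradSq, pdx, pdy, hz, ← hd]

theorem continuousOn_gradSq {n : ℕ} {a b : ℝ} (hab : a < b) {φ : ℝ → (Fin n → ℂ) → ℝ}
    (hφ : ContDiffOn ℝ (⊤ : ℕ∞) (fun p : ℝ × (Fin n → ℂ) => φ p.1 p.2) (Icc a b ×ˢ univ)) :
    ContinuousOn (fun p : ℝ × (Fin n → ℂ) => gradSq (φ p.1) p.2) (Icc a b ×ˢ univ) := by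
  set Φ : ℝ × (Fin n → ℂ) → ℝ := fun p => φ p.1 p.2 with hΦ
  have hc := hφ.continuousOn_fderivWithin ((uniqueDiffOn_Icc hab).prod uniqueDiffOn_univ)
    (by simp)
  have hv (v : Fin n → ℂ) :
      ContinuousOn (fun p : ℝ × (Fin n → ℂ) => fderiv ℝ (φ p.1) p.2 v) (Icc a b ×ˢ univ) := by
    refine (hc.clm_apply (continuousOn_const (c := ((0 : ℝ), v)))).congr ?_
    rintro ⟨t, z⟩ ht
    have h := ((hφ.differentiableOn (by simp) (t, z) ht).hasFDerivWithinAt).comp (s := univ) z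
      (hasFDerivAt_prodMk_right (𝕜 := ℝ) t z).hasFDerivWithinAt fun w _ => ⟨ht.1, mem_univ w⟩
    rw [hasFDerivWithinAt_univ] at h
    have h' : HasFDerivAt (φ t) _ z := h
    simp [h'.fderiv, hΦ]
  unfold gradSq pdx pdy
  exact continuousOn_finsetSum _ fun p _ => ((hv _).pow 2).add ((hv _).pow 2)

theorem gradSq_nonneg {n : ℕ} (ψ : (Fin n → ℂ) → ℝ) (z : Fin n → ℂ) : 0 ≤ gradSq ψ z :=
  Finset.sum_nonneg fun _ _ => by positivity

theorem spacePeriodic_fderiv_fst {n : ℕ} {F : ℝ → (Fin n → ℂ) → ℝ}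
    (hF : ContDiff ℝ (⊤ : ℕ∞) (fun p : ℝ × (Fin n → ℂ) => F p.1 p.2))
    (hper : ∀ s, SpacePeriodic (F s)) (s : ℝ) :
    SpacePeriodic fun z => fderiv ℝ (fun p : ℝ × (Fin n → ℂ) => F p.1 p.2) (s, z) (1, 0) := by
  have h (z : Fin n → ℂ) : fderiv ℝ (fun p : ℝ × (Fin n → ℂ) => F p.1 p.2) (s, z) (1, 0) =
      deriv (fun r => F r z) s := by
    have h1 := ((hF.differentiable (by simp) (s, z)).hasFDerivAt).comp_hasDerivAt s
      ((hasDerivAt_id s).prodMk (hasDerivAt_const s z))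
    have h2 : HasDerivAt (fun r => F r z) _ s := h1
    exact h2.deriv.symm
  intro z a b
  simp only [h, fun r => hper r z a b]

/-- Bound for `t log (1 + |∇φ|²)` on the half-open time interval. -/
theorem mul_log_one_add_gradSq_le {n : ℕ} {F : ℝ → (Fin n → ℂ) → ℝ}
    {φ : ℝ → (Fin n → ℂ) → ℝ} {T C₀ M₁ M₂ M₃ C₂ : ℝ}
    (hF : ContDiff ℝ (⊤ : ℕ∞) (fun p : ℝ × (Fin n → ℂ) => F p.1 p.2))
    (hM₁ : ∀ s ∈ Icc (-C₀) C₀, ∀ z, gradSq (F s) z ≤ M₁)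
    (hM₂ : ∀ s ∈ Icc (-C₀) C₀, ∀ z : Fin n → ℂ,
      |fderiv ℝ (fun p : ℝ × (Fin n → ℂ) => F p.1 p.2) (s, z) (1, 0)| ≤ M₂)
    (hM₃ : ∀ s ∈ Icc (-C₀) C₀, ∀ z, |F s z| ≤ M₃)
    (hC₂ : 0 ≤ C₂)
    (hC₂' : ∀ b : ℝ, 0 ≤ b → b ≤ n * (4 * Real.exp (C₀ + M₃)) * (Real.log (1 + b) +
      (T * (M₁ + 1 + 2 * M₂) + (3 * C₀ + 1) * (2 + n + C₀))) ^ n → b ≤ C₂)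
    (hsol : IsMAFlowSolution F 1 T φ)
    (hφ : ∀ t ∈ Icc (0 : ℝ) T, ∀ z, |φ t z| ≤ C₀)
    (hφt : ∀ t ∈ Icc (0 : ℝ) T, ∀ z, |Real.log (((1 : Matrix (Fin n) (Fin n) ℂ)
      + complexHessian (φ t) z).det.re) + F (φ t z) z| ≤ C₀)
    {t : ℝ} (ht : t ∈ Ioo 0 T) (z : Fin n → ℂ) :
    t * Real.log (1 + gradSq (φ t) z) ≤
      T * Real.log (1 + C₂) + 2 * ((2 * C₀ + 1) * C₀ + C₀ ^ 2 / 2) := by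
  have hT : 0 < T := ht.1.trans ht.2
  have hsub : Icc 0 t ⊆ Icc 0 T := Icc_subset_Icc_right ht.2.le
  have hcont : ContinuousOn (fun p : ℝ × (Fin n → ℂ) => p.1 * Real.log (1 + gradSq (φ p.1) p.2) -
      ((2 * C₀ + 1) * φ p.1 p.2 - φ p.1 p.2 ^ 2 / 2)) (Icc 0 T ×ˢ univ) := by
    refine (continuousOn_fst.mul ((continuousOn_const.add
      (continuousOn_gradSq hT hsol.1)).log fun p _ => ?_)).sub
      ((hsol.1.continuousOn.const_mul _).sub ((hsol.1.continuousOn.pow 2).div_const 2))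
    have := gradSq_nonneg (φ p.1) p.2
    simp only [Pi.add_apply]
    positivity
  obtain ⟨t₀, ht₀, z₀, hmax⟩ := exists_max_of_spacePeriodic ht.1.le
    (G := fun s w => s * Real.log (1 + gradSq (φ s) w) -
      ((2 * C₀ + 1) * φ s w - φ s w ^ 2 / 2))
    (hcont.mono (prod_mono hsub subset_rfl)) (fun s hs w a b => by
      simp only [hsol.2.1 s (hsub hs) w a b, (hsol.2.1 s (hsub hs)).gradSq w a b])
  have hγ (s : ℝ) (hs : s ∈ Icc 0 t) (w : Fin n → ℂ) :
      |(2 * C₀ + 1) * φ s w - φ s w ^ 2 / 2| ≤ (2 * C₀ + 1) * C₀ + C₀ ^ 2 / 2 := by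
    have h1 := hφ s (hsub hs) w
    have h2 : 0 ≤ C₀ := (abs_nonneg _).trans h1
    refine (abs_sub _ _).trans (add_le_add ?_ ?_)
    · rw [abs_mul, abs_of_nonneg (by positivity)]
      gcongr
    · rw [abs_div, abs_pow, abs_of_pos (two_pos : (0 : ℝ) < 2)]
      gcongr
  have hb := gradSq_nonneg (φ t₀) z₀
  have hlog : t₀ * Real.log (1 + gradSq (φ t₀) z₀) ≤ T * Real.log (1 + C₂) := by
    have hlogC : 0 ≤ Real.log (1 + C₂) := Real.log_nonneg (by linarith)
    rcases ht₀.1.eq_or_lt with h0 | h0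
    · rw [← h0, zero_mul]; positivity
    have hle := hC₂' _ hb (gradSq_le_at_max hF hM₁ hM₂ hM₃ hsol hφ hφt
      ⟨h0, ht₀.2.trans_lt ht.2⟩ z₀ (fun w => hmax t₀ ht₀ w)
      (fun s hs => hmax s ⟨hs.1, hs.2.trans ht₀.2⟩ z₀))
    exact mul_le_mul (ht₀.2.trans ht.2.le) (Real.log_le_log (by linarith) (by linarith))
      (Real.log_nonneg (by linarith)) hT.le
  have h1 := hmax t ⟨ht.1.le, le_rfl⟩ z
  have h2 := (abs_le.mp (hγ t ⟨ht.1.le, le_rfl⟩ z)).2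
  have h3 := (abs_le.mp (hγ t₀ ht₀ z₀)).1
  linarith

/-- Lemma 2.2 of the paper, flat torus case: if `φ` solves the flow
`∂φ/∂t = log det(Iₙ + H(φ)) + F(φ,z)` on `[0,T]` with `|φ| ≤ C₀` and `|φ̇| ≤ C₀`,
then there is `C > 0` depending only on `F, C₀, T` with
`|∇φ(t,·)|² ≤ e^{C/t}` for all `t ∈ (0,T]`. -/
theorem stmt9 (n : ℕ) (F : ℝ → (Fin n → ℂ) → ℝ)
    (hF : ContDiff ℝ (⊤ : ℕ∞) (fun p : ℝ × (Fin n → ℂ) => F p.1 p.2))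
    (hFper : ∀ s : ℝ, SpacePeriodic (F s))
    (T : ℝ) (hT : 0 < T) (C₀ : ℝ) (hC₀ : 0 < C₀) :
    ∃ C > (0 : ℝ), ∀ φ : ℝ → (Fin n → ℂ) → ℝ,
      IsMAFlowSolution F 1 T φ →
      (∀ t ∈ Icc (0 : ℝ) T, ∀ z, |φ t z| ≤ C₀) →
      (∀ t ∈ Icc (0 : ℝ) T, ∀ z,
        |Real.log (((1 : Matrix (Fin n) (Fin n) ℂ)
          + complexHessian (φ t) z).det.re) + F (φ t z) z| ≤ C₀) →
      ∀ t ∈ Ioc (0 : ℝ) T, ∀ z, gradSq (φ t) z ≤ Real.exp (C / t) := by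
  have hI : -C₀ < C₀ := by linarith
  obtain ⟨s₁, -, z₁, hM₁⟩ := exists_max_of_spacePeriodic hI.le
    (continuousOn_gradSq hI hF.contDiffOn) fun s _ => (hFper s).gradSq
  obtain ⟨s₂, -, z₂, hM₂⟩ := exists_max_of_spacePeriodic hI.le
    (G := fun s z => |fderiv ℝ (fun p : ℝ × (Fin n → ℂ) => F p.1 p.2) (s, z) (1, 0)|)
    ((hF.continuous_fderiv (by simp)).clm_apply continuous_const).abs.continuousOn
    fun s _ z a b => congrArg abs (spacePeriodic_fderiv_fst hF hFper s z a b)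
  obtain ⟨s₃, -, z₃, hM₃⟩ := exists_max_of_spacePeriodic hI.le (G := fun s z => |F s z|)
    hF.continuous.abs.continuousOn fun s _ z a b => congrArg abs (hFper s z a b)
  obtain ⟨C₂, hC₂, hC₂'⟩ := exists_bound_of_le_log_pow n _ _
  have hlogC : 0 ≤ Real.log (1 + C₂) := Real.log_nonneg (by linarith)
  refine ⟨T * Real.log (1 + C₂) + 2 * ((2 * C₀ + 1) * C₀ + C₀ ^ 2 / 2), by positivity,
    fun φ hsol hφ hφt => ?_⟩
  have hopen : ∀ t ∈ Ioo 0 T, ∀ z, gradSq (φ t) z ≤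
      Real.exp ((T * Real.log (1 + C₂) + 2 * ((2 * C₀ + 1) * C₀ + C₀ ^ 2 / 2)) / t) := by
    intro t ht z
    have hb := gradSq_nonneg (φ t) z
    have h := mul_log_one_add_gradSq_le hF hM₁ hM₂ hM₃ hC₂ hC₂' hsol hφ hφt ht z
    rw [mul_comm, ← le_div_iff₀ ht.1, Real.log_le_iff_le_exp (by positivity)] at h
    linarith
  intro t ht z
  rcases ht.2.lt_or_eq with hlt | rfl
  · exact hopen t ⟨ht.1, hlt⟩ z
  have hcont : ContinuousWithinAt (fun s => gradSq (φ s) z) (Icc 0 t) t :=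
    (continuousOn_gradSq hT hsol.1 (t, z) ⟨right_mem_Icc.mpr hT.le, mem_univ z⟩).comp
      (f := fun s => (s, z)) (by fun_prop) fun s hs => ⟨hs, mem_univ z⟩
  have hmono : 𝓝[<] t ≤ 𝓝[Icc 0 t] t := by
    rw [← nhdsWithin_Ioo_eq_nhdsLT hT]
    exact nhdsWithin_mono _ Ioo_subset_Icc_self
  refine le_of_tendsto_of_tendsto (b := 𝓝[<] t) (hcont.mono_left hmono)
    (((tendsto_const_nhds.div (tendsto_id.mono_left nhdsWithin_le_nhds) ht.1.ne').rexp)) ?_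
  filter_upwards [Ioo_mem_nhdsLT hT] with s hs
  exact hopen s hs z

end
end

section
/- Let F : ℝ × ℂⁿ → ℝ be smooth and periodic in the second variable, let T > 0, c_j, c_k > 0, and C₀ > 0. Let φ_j and φ_k be solutions on [0,T] of the flows ∂φ_j/∂t = log det(Iₙ + H(φ_j(t,·))) + F(φ_j, z) − log c_j and ∂φ_k/∂t = log det(Iₙ + H(φ_k(t,·))) + F(φ_k, z) − log c_k respectively, with |φ_j(t,z)| ≤ C₀ and |φ_k(t,z)| ≤ C₀ on [0,T] × ℂⁿ. Let κ > 0 be such that |F(s,z) − F(s',z)| ≤ κ|s − s'| for all s, s' ∈ [−C₀, C₀] and all z. Then sup_{[0,T]×ℂⁿ} |φ_j − φ_k| ≤ e^{κT}·( sup_z |φ_j(0,z) − φ_k(0,z)| + κ⁻¹·|log(c_k/c_j)| ) − κ⁻¹·|log(c_k/c_j)|. -/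
open Set Filter Topology
open scoped ComplexOrder

noncomputable section

section Matrix

variable {ι : Type*} [Fintype ι] [DecidableEq ι]

open scoped Matrix

/-- A Hermitian matrix `1 + Q` with `Q` positive semidefinite has determinant at least `1`. -/
lemma Matrix.PosSemidef.one_le_re_det_one_add {Q : Matrix ι ι ℂ} (hQ : Q.PosSemidef) :
    1 ≤ (1 + Q).det.re := by
  have hH : (1 + Q).IsHermitian := (Matrix.PosSemidef.one.add hQ).1
  have h1 : ∀ i, 1 ≤ hH.eigenvalues i := by
    intro i
    have hv : star (hH.eigenvectorBasis i).ofLp ⬝ᵥ (hH.eigenvectorBasis i).ofLp = 1 := by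
      have h := inner_self_eq_norm_sq_to_K (𝕜 := ℂ) (hH.eigenvectorBasis i)
      rw [hH.eigenvectorBasis.orthonormal.1 i, EuclideanSpace.inner_eq_star_dotProduct,
        dotProduct_comm] at h
      simpa using h
    rw [hH.eigenvalues_eq, Matrix.add_mulVec, dotProduct_add, Matrix.one_mulVec, hv]
    simpa using hQ.re_dotProduct_nonneg (hH.eigenvectorBasis i).ofLp
  rw [hH.det_eq_prod_eigenvalues]
  have : (∏ i, (hH.eigenvalues i : ℂ)) = ((∏ i, hH.eigenvalues i : ℝ) : ℂ) := by
    push_cast; rfl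
  erw [this, Complex.ofReal_re]
  simpa using Finset.prod_le_prod (s := Finset.univ) (fun _ _ => zero_le_one) fun i _ => h1 i

open scoped MatrixOrder in
/-- The determinant is monotone for the Loewner order on positive definite matrices. -/
lemma Matrix.PosDef.re_det_le {A B : Matrix ι ι ℂ} (hA : A.PosDef) (hAB : (B - A).PosSemidef) :
    A.det.re ≤ B.det.re := by
  obtain ⟨R, hR⟩ := CStarAlgebra.nonneg_iff_eq_star_mul_self.mp hA.posSemidef.nonneg
  rw [Matrix.star_eq_conjTranspose] at hR
  have hdet : IsUnit R.det := by
    have h := hA.det_pos.ne'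
    rw [hR, Matrix.det_mul] at h
    exact (right_ne_zero_of_mul h).isUnit
  have hinv : R⁻¹ * R = 1 := Matrix.nonsing_inv_mul R hdet
  have hinv' : Rᴴ * (R⁻¹)ᴴ = 1 := by
    rw [← Matrix.conjTranspose_mul, hinv, Matrix.conjTranspose_one]
  have hQ := hAB.conjTranspose_mul_mul_same R⁻¹
  have hB : B = Rᴴ * (1 + (R⁻¹)ᴴ * (B - A) * R⁻¹) * R := by
    have : Rᴴ * (1 + (R⁻¹)ᴴ * (B - A) * R⁻¹) * R
        = Rᴴ * R + (Rᴴ * (R⁻¹)ᴴ) * (B - A) * (R⁻¹ * R) := by noncomm_ring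
    rw [this, hinv, hinv', ← hR]
    simp
  have hBdet : B.det = A.det * (1 + (R⁻¹)ᴴ * (B - A) * R⁻¹).det := by
    have hAdet : A.det = Rᴴ.det * R.det := by
      conv_lhs => rw [hR, Matrix.det_mul]
    conv_lhs => rw [hB, Matrix.det_mul, Matrix.det_mul]
    rw [hAdet]
    ring
  have hpos := Complex.pos_iff.mp hA.det_pos
  rw [hBdet, Complex.mul_re, ← hpos.2]
  nlinarith [hQ.one_le_re_det_one_add, hpos.1]

end Matrix

section SecondDerivative

variable {E : Type*} [NormedAddCommGroup E] [NormedSpace ℝ E]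

/-- At a global maximum, the second derivative is nonpositive in every direction. -/
lemma fderiv_fderiv_nonpos_of_forall_le {f : E → ℝ} (hf : ContDiff ℝ 2 f) {z : E}
    (hmax : ∀ y, f y ≤ f z) (w : E) : fderiv ℝ (fderiv ℝ f) z w w ≤ 0 := by
  have hline : ∀ s : ℝ, HasDerivAt (fun s : ℝ => z + s • w) w s := fun s => by
    simpa using ((hasDerivAt_id s).smul_const w).const_add z
  have h1 : deriv (fun s : ℝ => f (z + s • w)) = fun s => fderiv ℝ f (z + s • w) w := by
    funext s
    exact ((hf.differentiable (by norm_num) _).hasFDerivAt.comp_hasDerivAt s (hline s)).deriv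
  have hd : ContDiff ℝ 1 (fderiv ℝ f) := hf.fderiv_right (by norm_num)
  have h2 : deriv (deriv (fun s : ℝ => f (z + s • w))) 0 = fderiv ℝ (fderiv ℝ f) z w w := by
    rw [h1]
    have h := ((hd.differentiable (by norm_num) _).hasFDerivAt.comp_hasDerivAt (0 : ℝ)
      (hline 0)).clm_apply (hasDerivAt_const (0 : ℝ) w)
    simpa using h.deriv
  by_contra! hlt
  have hM : IsLocalMax (fun s : ℝ => f (z + s • w)) 0 :=
    Eventually.of_forall fun s => by simpa using hmax (z + s • w)
  have hcont : Continuous fun s : ℝ => f (z + s • w) := hf.continuous.comp (by fun_prop)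
  have hm : IsLocalMin (fun s : ℝ => f (z + s • w)) 0 :=
    isLocalMin_of_deriv_deriv_pos (by rw [h2]; exact hlt) hM.deriv_eq_zero hcont.continuousAt
  have heq : (fun s : ℝ => f (z + s • w)) =ᶠ[𝓝 0] fun _ => f z := by
    filter_upwards [hM, hm] with s hs hs'
    simpa using le_antisymm hs hs'
  have h0 : deriv (deriv (fun s : ℝ => f (z + s • w))) 0 = 0 := by
    rw [heq.deriv.deriv_eq]
    simp
  linarith

end SecondDerivative

section ComplexHessian

variable {n : ℕ}

lemma fderiv_fderiv_apply_const {f : (Fin n → ℂ) → ℝ} (hf : ContDiff ℝ 2 f)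
    (z v w : Fin n → ℂ) :
    fderiv ℝ (fun y => fderiv ℝ f y w) z v = fderiv ℝ (fderiv ℝ f) z v w := by
  have hd : ContDiff ℝ 1 (fderiv ℝ f) := hf.fderiv_right (by norm_num)
  rw [fderiv_clm_apply (hd.differentiable (by norm_num) z) (differentiableAt_const w)]
  simp

/-- The complex Hessian in terms of the second Fréchet derivative. -/
lemma complexHessian_apply {f : (Fin n → ℂ) → ℝ} (hf : ContDiff ℝ 2 f) (z : Fin n → ℂ)
    (p q : Fin n) :
    complexHessian f z p q =
      (1 / 4 : ℂ) * ((fderiv ℝ (fderiv ℝ f) z (Pi.single p 1) (Pi.single q 1)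
        + fderiv ℝ (fderiv ℝ f) z (Pi.single p Complex.I) (Pi.single q Complex.I) : ℝ) : ℂ) +
      (Complex.I / 4) * ((fderiv ℝ (fderiv ℝ f) z (Pi.single p 1) (Pi.single q Complex.I)
        - fderiv ℝ (fderiv ℝ f) z (Pi.single p Complex.I) (Pi.single q 1) : ℝ) : ℂ) := by
  simp only [← fderiv_fderiv_apply_const hf]
  rfl

lemma complexHessian_sub {f g : (Fin n → ℂ) → ℝ} (hf : ContDiff ℝ 2 f) (hg : ContDiff ℝ 2 g)
    (z : Fin n → ℂ) :
    complexHessian (f - g) z = complexHessian f z - complexHessian g z := by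
  have hdf : ContDiff ℝ 1 (fderiv ℝ f) := hf.fderiv_right (by norm_num)
  have hdg : ContDiff ℝ 1 (fderiv ℝ g) := hg.fderiv_right (by norm_num)
  have h1 : fderiv ℝ (f - g) = fderiv ℝ f - fderiv ℝ g := by
    funext y
    exact fderiv_sub (hf.differentiable (by norm_num) y) (hg.differentiable (by norm_num) y)
  have h2 : fderiv ℝ (fderiv ℝ (f - g)) z
      = fderiv ℝ (fderiv ℝ f) z - fderiv ℝ (fderiv ℝ g) z := by
    rw [h1]
    exact fderiv_sub (hdf.differentiable (by norm_num) z) (hdg.differentiable (by norm_num) z)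
  have hfg : ContDiff ℝ 2 (f - g) := hf.sub hg
  ext p q
  rw [Matrix.sub_apply, complexHessian_apply hfg, complexHessian_apply hf,
    complexHessian_apply hg, h2]
  simp only [sub_apply]
  push_cast
  ring

lemma complexHessian_isHermitian {f : (Fin n → ℂ) → ℝ} (hf : ContDiff ℝ 2 f) (z : Fin n → ℂ) :
    (complexHessian f z).IsHermitian := by
  have hs : IsSymmSndFDerivAt ℝ f z := hf.contDiffAt.isSymmSndFDerivAt (by simp)
  ext p q
  rw [Matrix.conjTranspose_apply, complexHessian_apply hf, complexHessian_apply hf,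
    hs.eq (Pi.single q 1) (Pi.single p 1),
    hs.eq (Pi.single q Complex.I) (Pi.single p Complex.I),
    hs.eq (Pi.single q 1) (Pi.single p Complex.I),
    hs.eq (Pi.single q Complex.I) (Pi.single p 1)]
  apply Complex.ext
  · simp
  · simp
    ring

lemma sum_single_one_add_single_I (w : Fin n → ℂ) :
    w = ∑ p, ((w p).re • (Pi.single p (1 : ℂ) : Fin n → ℂ)
      + (w p).im • (Pi.single p Complex.I : Fin n → ℂ)) := by
  funext q
  simp only [Finset.sum_apply, Pi.add_apply, Pi.smul_apply, Pi.single_apply, Complex.real_smul]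
  simp [Finset.sum_add_distrib, Complex.re_add_im]

lemma bilin_eq_sum (Q : (Fin n → ℂ) →L[ℝ] (Fin n → ℂ) →L[ℝ] ℝ) (w : Fin n → ℂ) :
    Q w w = ∑ p, ∑ q,
      ((w p).re * (w q).re * Q (Pi.single p 1) (Pi.single q 1)
        + (w p).re * (w q).im * Q (Pi.single p 1) (Pi.single q Complex.I)
        + (w p).im * (w q).re * Q (Pi.single p Complex.I) (Pi.single q 1)
        + (w p).im * (w q).im * Q (Pi.single p Complex.I) (Pi.single q Complex.I)) := by
  conv_lhs => rw [sum_single_one_add_single_I w]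
  simp only [map_sum, sum_apply]
  rw [Finset.sum_comm]
  refine Finset.sum_congr rfl fun p _ => Finset.sum_congr rfl fun q _ => ?_
  simp only [map_add, map_smul, add_apply, smul_apply,
    smul_eq_mul]
  ring

open scoped Matrix in
/-- The Levi form is the average of the second derivatives along `w` and `i w`, for `w = v̄`. -/
lemma re_dotProduct_complexHessian_mulVec {f : (Fin n → ℂ) → ℝ} (hf : ContDiff ℝ 2 f)
    (z v : Fin n → ℂ) :
    (star v ⬝ᵥ (complexHessian f z *ᵥ v)).re =
      (1 / 4) * (fderiv ℝ (fderiv ℝ f) z (star v) (star v)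
        + fderiv ℝ (fderiv ℝ f) z (Complex.I • star v) (Complex.I • star v)) := by
  rw [bilin_eq_sum, bilin_eq_sum, ← Finset.sum_add_distrib, Finset.mul_sum]
  simp only [dotProduct, Matrix.mulVec, Finset.mul_sum, Complex.re_sum]
  refine Finset.sum_congr rfl fun p _ => ?_
  rw [← Finset.sum_add_distrib, Finset.mul_sum]
  refine Finset.sum_congr rfl fun q _ => ?_
  rw [complexHessian_apply hf]
  simp
  ring

lemma posSemidef_neg_complexHessian_of_forall_le {f : (Fin n → ℂ) → ℝ} (hf : ContDiff ℝ 2 f)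
    {z : Fin n → ℂ} (hmax : ∀ y, f y ≤ f z) : (-complexHessian f z).PosSemidef := by
  have hH : (-complexHessian f z).IsHermitian := (complexHessian_isHermitian hf z).neg
  refine Matrix.PosSemidef.of_dotProduct_mulVec_nonneg hH fun v => ?_
  rw [Complex.nonneg_iff]
  constructor
  · rw [Matrix.neg_mulVec, dotProduct_neg, Complex.neg_re,
      re_dotProduct_complexHessian_mulVec hf]
    linarith [fderiv_fderiv_nonpos_of_forall_le hf hmax (star v),
      fderiv_fderiv_nonpos_of_forall_le hf hmax (Complex.I • star v)]
  · exact (hH.im_star_dotProduct_mulVec_self v).symm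

/-- Comparison of Monge–Ampère operators at a maximum point of the difference. -/
lemma log_det_le_log_det_of_forall_sub_le {f g : (Fin n → ℂ) → ℝ} (hf : ContDiff ℝ 2 f)
    (hg : ContDiff ℝ 2 g) {z : Fin n → ℂ} (hmax : ∀ y, f y - g y ≤ f z - g z)
    (hpos : ((1 : Matrix (Fin n) (Fin n) ℂ) + complexHessian f z).PosDef) :
    Real.log ((1 : Matrix (Fin n) (Fin n) ℂ) + complexHessian f z).det.re ≤
      Real.log ((1 : Matrix (Fin n) (Fin n) ℂ) + complexHessian g z).det.re := by
  have h := posSemidef_neg_complexHessian_of_forall_le (hf.sub hg) hmax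
  change (-complexHessian (f - g) z).PosSemidef at h
  rw [complexHessian_sub hf hg] at h
  refine Real.log_le_log (Complex.pos_iff.mp hpos.det_pos).1 (hpos.re_det_le ?_)
  convert h using 1
  abel

end ComplexHessian

section Flow

variable {n : ℕ}

/-- The closed unit box in `ℂⁿ`, which meets every orbit of the lattice `ℤⁿ + iℤⁿ`. -/
def unitBox (n : ℕ) : Set (Fin n → ℂ) :=
  univ.pi fun _ => Icc (0 : ℝ) 1 ×ℂ Icc (0 : ℝ) 1

lemma isCompact_unitBox : IsCompact (unitBox n) :=
  isCompact_univ_pi fun _ => isCompact_Icc.reProdIm isCompact_Icc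

lemma exists_mem_unitBox (z : Fin n → ℂ) :
    ∃ a b : Fin n → ℤ, (fun p => z p + (a p : ℂ) + (b p : ℂ) * Complex.I) ∈ unitBox n := by
  refine ⟨fun p => -⌊(z p).re⌋, fun p => -⌊(z p).im⌋, fun p _ => ?_⟩
  rw [Complex.mem_reProdIm]
  have h1 := Int.floor_le (z p).re
  have h2 := (Int.lt_floor_add_one (z p).re).le
  have h3 := Int.floor_le (z p).im
  have h4 := (Int.lt_floor_add_one (z p).im).le
  simp only [mem_Icc]
  refine ⟨⟨?_, ?_⟩, ?_, ?_⟩ <;> simp <;> linarith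

lemma IsMAFlowSolution.contDiff_slice {F : ℝ → (Fin n → ℂ) → ℝ} {c T : ℝ}
    {φ : ℝ → (Fin n → ℂ) → ℝ} (h : IsMAFlowSolution F c T φ) {t : ℝ} (ht : t ∈ Icc (0 : ℝ) T) :
    ContDiff ℝ 2 (φ t) := by
  have h1 : ContDiffOn ℝ 2 (fun p : ℝ × (Fin n → ℂ) => φ p.1 p.2) (Icc 0 T ×ˢ univ) :=
    h.1.of_le (WithTop.coe_le_coe.mpr le_top)
  rw [← contDiffOn_univ]
  exact h1.comp (g := fun p : ℝ × (Fin n → ℂ) => φ p.1 p.2)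
    (contDiff_prodMk_right t).contDiffOn fun z _ => ⟨ht, mem_univ z⟩

/-- A differentiable function on `[0,T]` attaining its maximum at `t₀ > 0` has nonnegative
derivative there. -/
lemma HasDerivWithinAt.nonneg_of_forall_le {f : ℝ → ℝ} {f' T t₀ : ℝ} (ht₀ : t₀ ∈ Icc (0 : ℝ) T)
    (hpos : 0 < t₀) (hf : HasDerivWithinAt f f' (Icc 0 T) t₀)
    (hmax : ∀ t ∈ Icc (0 : ℝ) T, f t ≤ f t₀) : 0 ≤ f' := by
  have hloc : IsLocalMaxOn f (Icc 0 T) t₀ := eventually_nhdsWithin_of_forall hmax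
  have hcone : (0 : ℝ) - t₀ ∈ posTangentConeAt (Icc 0 T) t₀ :=
    sub_mem_posTangentConeAt_of_segment_subset
      ((convex_Icc 0 T).segment_subset ht₀ ⟨le_rfl, ht₀.1.trans ht₀.2⟩)
  have h := hloc.hasFDerivWithinAt_nonpos hf.hasFDerivWithinAt hcone
  simp at h
  nlinarith

/-- One-sided comparison between two flows, with exponential weight and slack `ε`. -/
lemma IsMAFlowSolution.exp_mul_sub_le {F : ℝ → (Fin n → ℂ) → ℝ} {T : ℝ} {c d : ℝ} {κ : ℝ}
    (hκ : 0 < κ) {φ ψ : ℝ → (Fin n → ℂ) → ℝ}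
    (hφ : IsMAFlowSolution F c T φ) (hψ : IsMAFlowSolution F d T ψ)
    (hlip : ∀ t ∈ Icc (0 : ℝ) T, ∀ z, |F (φ t z) z - F (ψ t z) z| ≤ κ * |φ t z - ψ t z|)
    {L M : ℝ} (hL : 0 < L) (hcd : Real.log d - Real.log c < L) (hM : 0 ≤ M)
    (hinit : ∀ z, φ 0 z - ψ 0 z ≤ M) {t : ℝ} (ht : t ∈ Icc (0 : ℝ) T) (z : Fin n → ℂ) :
    Real.exp (-(κ * t)) * (φ t z - ψ t z + κ⁻¹ * L) ≤ M + κ⁻¹ * L := by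
  set W : ℝ → (Fin n → ℂ) → ℝ :=
    fun t z => Real.exp (-(κ * t)) * (φ t z - ψ t z + κ⁻¹ * L) with hW
  have hper : ∀ s ∈ Icc (0 : ℝ) T, SpacePeriodic (W s) := fun s hs y a b => by
    simp only [hW]
    rw [hφ.2.1 s hs y a b, hψ.2.1 s hs y a b]
  have hcont : ContinuousOn (fun p : ℝ × (Fin n → ℂ) => W p.1 p.2)
      (Icc 0 T ×ˢ unitBox n) := by
    have h1 := hφ.1.continuousOn.mono (prod_mono_right (subset_univ (unitBox n)))
    have h2 := hψ.1.continuousOn.mono (prod_mono_right (subset_univ (unitBox n)))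
    exact (Continuous.continuousOn (by fun_prop)).mul ((h1.sub h2).add continuousOn_const)
  obtain ⟨a, b, hab⟩ := exists_mem_unitBox z
  obtain ⟨⟨t₀, z₀⟩, ⟨ht₀, -⟩, hbox⟩ :=
    (isCompact_Icc.prod isCompact_unitBox).exists_isMaxOn ⟨(t, _), ht, hab⟩ hcont
  have hmax : ∀ s ∈ Icc (0 : ℝ) T, ∀ y, W s y ≤ W t₀ z₀ := fun s hs y => by
    obtain ⟨a, b, hab⟩ := exists_mem_unitBox y
    rw [← hper s hs y a b]
    exact hbox (show (s, _) ∈ Icc 0 T ×ˢ unitBox n from ⟨hs, hab⟩)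
  refine (hmax t ht z).trans ?_
  by_contra! hlt
  have hκL : 0 < κ⁻¹ * L := by positivity
  have ht₀pos : 0 < t₀ := by
    refine ht₀.1.lt_of_ne fun h => ?_
    subst h
    simp only [hW, mul_zero, neg_zero, Real.exp_zero, one_mul] at hlt
    linarith [hinit z₀]
  have hdiff : 0 ≤ φ t₀ z₀ - ψ t₀ z₀ := by
    by_contra! hneg
    have hexp : Real.exp (-(κ * t₀)) ≤ 1 := Real.exp_le_one_iff.mpr (by
      have := mul_pos hκ ht₀pos
      linarith)
    have : W t₀ z₀ ≤ κ⁻¹ * L := by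
      simp only [hW]
      nlinarith [Real.exp_pos (-(κ * t₀))]
    linarith
  have hspace : ∀ y, φ t₀ y - ψ t₀ y ≤ φ t₀ z₀ - ψ t₀ z₀ := fun y => by
    have := le_of_mul_le_mul_left (hmax t₀ ht₀ y) (Real.exp_pos _)
    linarith
  have hlog := log_det_le_log_det_of_forall_sub_le (hφ.contDiff_slice ht₀)
    (hψ.contDiff_slice ht₀) hspace (hφ.2.2.1 t₀ ht₀ z₀)
  have hF := (le_abs_self _).trans (hlip t₀ ht₀ z₀)
  rw [abs_of_nonneg hdiff] at hF
  have hexp : HasDerivWithinAt (fun s : ℝ => Real.exp (-(κ * s)))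
      (Real.exp (-(κ * t₀)) * -κ) (Icc 0 T) t₀ := by
    have h : HasDerivAt (fun s : ℝ => -(κ * s)) (-κ) t₀ := by
      simpa using (hasDerivAt_id t₀).const_mul (-κ)
    exact h.exp.hasDerivWithinAt
  have hderiv := hexp.mul
    (((hφ.2.2.2 t₀ ht₀ z₀).sub (hψ.2.2.2 t₀ ht₀ z₀)).add_const (κ⁻¹ * L))
  have hnonneg := hderiv.nonneg_of_forall_le ht₀ ht₀pos fun s hs => hmax s hs z₀
  have hκκ : κ * (κ⁻¹ * L) = L := by field_simp
  have hpos := Real.exp_pos (-(κ * t₀))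
  simp only [Pi.sub_apply] at hnonneg
  rw [mul_assoc, ← mul_add] at hnonneg
  have := nonneg_of_mul_nonneg_right hnonneg hpos
  linarith

/-- One-sided comparison between two flows. -/
lemma IsMAFlowSolution.sub_le {F : ℝ → (Fin n → ℂ) → ℝ} {T : ℝ} {c d : ℝ} {κ : ℝ}
    (hκ : 0 < κ) {φ ψ : ℝ → (Fin n → ℂ) → ℝ}
    (hφ : IsMAFlowSolution F c T φ) (hψ : IsMAFlowSolution F d T ψ)
    (hlip : ∀ t ∈ Icc (0 : ℝ) T, ∀ z, |F (φ t z) z - F (ψ t z) z| ≤ κ * |φ t z - ψ t z|)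
    {L M : ℝ} (hL : 0 ≤ L) (hcd : Real.log d - Real.log c ≤ L) (hM : 0 ≤ M)
    (hinit : ∀ z, φ 0 z - ψ 0 z ≤ M) {t : ℝ} (ht : t ∈ Icc (0 : ℝ) T) (z : Fin n → ℂ) :
    φ t z - ψ t z ≤ Real.exp (κ * T) * (M + κ⁻¹ * L) - κ⁻¹ * L := by
  have hlim : Real.exp (-(κ * t)) * (φ t z - ψ t z + κ⁻¹ * L) ≤ M + κ⁻¹ * L := by
    have h1 : Tendsto (fun ε : ℝ => Real.exp (-(κ * t)) * (φ t z - ψ t z + κ⁻¹ * (L + ε)))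
        (𝓝[>] 0) (𝓝 (Real.exp (-(κ * t)) * (φ t z - ψ t z + κ⁻¹ * (L + 0)))) :=
      (Continuous.tendsto (by fun_prop) 0).mono_left nhdsWithin_le_nhds
    have h2 : Tendsto (fun ε : ℝ => M + κ⁻¹ * (L + ε)) (𝓝[>] 0) (𝓝 (M + κ⁻¹ * (L + 0))) :=
      (Continuous.tendsto (by fun_prop) 0).mono_left nhdsWithin_le_nhds
    rw [add_zero] at h1 h2
    refine le_of_tendsto_of_tendsto h1 h2 (eventually_nhdsWithin_of_forall fun ε hε => ?_)
    have hε : 0 < ε := hε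
    exact hφ.exp_mul_sub_le hκ hψ hlip (by linarith) (by linarith) hM hinit ht z
  rw [Real.exp_neg, inv_mul_le_iff₀ (Real.exp_pos _)] at hlim
  have hmono : Real.exp (κ * t) ≤ Real.exp (κ * T) :=
    Real.exp_le_exp.mpr (mul_le_mul_of_nonneg_left ht.2 hκ.le)
  have := mul_le_mul_of_nonneg_right hmono (show 0 ≤ M + κ⁻¹ * L by positivity)
  linarith

end Flow

/-- Cauchy-sequence / stability lemma of Section 3, flat torus case:
if `φ_j`, `φ_k` solve the flows with constants `c_j`, `c_k`, both bounded by `C₀`, and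
`κ` is a Lipschitz constant for `F(·,z)` on `[−C₀, C₀]`, then
`sup |φ_j − φ_k| ≤ e^{κT}(sup_z|φ_j(0,z) − φ_k(0,z)| + κ⁻¹|log(c_k/c_j)|) − κ⁻¹|log(c_k/c_j)|`. -/
theorem stmt12 (n : ℕ) (F : ℝ → (Fin n → ℂ) → ℝ)
    (hF : ContDiff ℝ (⊤ : ℕ∞) (fun p : ℝ × (Fin n → ℂ) => F p.1 p.2))
    (hFper : ∀ s : ℝ, SpacePeriodic (F s))
    (T : ℝ) (hT : 0 < T) (cj ck : ℝ) (hcj : 0 < cj) (hck : 0 < ck)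
    (C₀ : ℝ) (hC₀ : 0 < C₀) (κ : ℝ) (hκ : 0 < κ)
    (φj φk : ℝ → (Fin n → ℂ) → ℝ)
    (hφj : IsMAFlowSolution F cj T φj) (hφk : IsMAFlowSolution F ck T φk)
    (hbj : ∀ t ∈ Icc (0 : ℝ) T, ∀ z, |φj t z| ≤ C₀)
    (hbk : ∀ t ∈ Icc (0 : ℝ) T, ∀ z, |φk t z| ≤ C₀)
    (hlip : ∀ s ∈ Icc (-C₀) C₀, ∀ s' ∈ Icc (-C₀) C₀, ∀ z : Fin n → ℂ,
      |F s z - F s' z| ≤ κ * |s - s'|) :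
    ∀ t ∈ Icc (0 : ℝ) T, ∀ z,
      |φj t z - φk t z| ≤
        Real.exp (κ * T) * ((⨆ w : Fin n → ℂ, |φj 0 w - φk 0 w|)
            + κ⁻¹ * |Real.log (ck / cj)|)
          - κ⁻¹ * |Real.log (ck / cj)| := by
  intro t ht z
  have h0 : (0 : ℝ) ∈ Icc (0 : ℝ) T := ⟨le_rfl, hT.le⟩
  have hbdd : BddAbove (range fun w : Fin n → ℂ => |φj 0 w - φk 0 w|) := by
    refine ⟨C₀ + C₀, ?_⟩
    rintro _ ⟨w, rfl⟩
    exact (abs_sub _ _).trans (add_le_add (hbj 0 h0 w) (hbk 0 h0 w))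
  have hinit : ∀ w, |φj 0 w - φk 0 w| ≤ ⨆ w : Fin n → ℂ, |φj 0 w - φk 0 w| := le_ciSup hbdd
  have hM : 0 ≤ ⨆ w : Fin n → ℂ, |φj 0 w - φk 0 w| := Real.iSup_nonneg fun w => abs_nonneg _
  have hlip' : ∀ t ∈ Icc (0 : ℝ) T, ∀ z,
      |F (φj t z) z - F (φk t z) z| ≤ κ * |φj t z - φk t z| := fun t ht z =>
    hlip _ (abs_le.mp (hbj t ht z)) _ (abs_le.mp (hbk t ht z)) z
  have hlog : Real.log (ck / cj) = Real.log ck - Real.log cj := Real.log_div hck.ne' hcj.ne'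
  refine abs_le'.mpr ⟨?_, ?_⟩
  · exact hφj.sub_le hκ hφk hlip' (abs_nonneg _) (hlog ▸ le_abs_self _) hM
      (fun w => (le_abs_self _).trans (hinit w)) ht z
  · rw [neg_sub]
    refine hφk.sub_le hκ hφj (fun t ht z => ?_) (abs_nonneg _) ?_ hM (fun w => ?_) ht z
    · rw [abs_sub_comm, abs_sub_comm (φk t z)]
      exact hlip' t ht z
    · rw [hlog, abs_sub_comm]
      exact le_abs_self _
    · exact (le_abs_self _).trans (abs_sub_comm (φk 0 w) _ ▸ hinit w)

end
end
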